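/- Let α ≥ 0 be a real number. There exists an (effectively computable) positive integer N_T(α) such that for all integers n ≥ N_T(α), the sequence r_α satisfies the strict reverse higher order Turán inequality at n: 4·(r_α(n)² − r_α(n−1)·r_α(n+1))·(r_α(n+1)² − r_α(n)·r_α(n+2)) − (r_α(n)·r_α(n+1) − r_α(n−1)·r_α(n+2))² < 0. -/

import Mathlib

open Real

/-- The overpartition function. -/
noncomputable def pbar (n : ℕ) : ℕ :=
  ∑ k ∈ Finset.range (n + 1),
    (Nat.Partition.distincts k).card * Fintype.card (Nat.Partition (n - k))

/-- `r_α(n) = (p̄(n)/n^α)^(1/n)`. -/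
noncomputable def rseq (α : ℝ) (n : ℕ) : ℝ :=
  ((pbar n : ℝ) / (n : ℝ) ^ α) ^ ((n : ℝ)⁻¹)

open Filter Topology

/-! ### The generating function -/

/-- The `i`-th factor of the product generating function of overpartitions. -/
noncomputable def overFactor (i : ℕ) : PowerSeries ℂ :=
  (1 + PowerSeries.X ^ (i + 1)) * PowerSeries.mk fun n => if i + 1 ∣ n then 1 else 0

open PowerSeries PowerSeries.WithPiTopology in
lemma tendsto_coeff_prod_overFactor (n : ℕ) :
    Tendsto (fun K => PowerSeries.coeff n (∏ i ∈ Finset.range K, overFactor i)) atTop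
      (𝓝 (pbar n : ℂ)) := by
  have h1 := Nat.Partition.hasProd_powerSeriesMk_card_countRestricted ℂ (m := 2) (by norm_num)
  have h2 := Nat.Partition.hasProd_powerSeriesMk_card_restricted ℂ (fun _ => True)
  have h3 := (h1.mul h2).tendsto_prod_nat
  rw [WithPiTopology.tendsto_iff_coeff_tendsto] at h3
  have h4 := h3 n
  have e1 : ∀ i : ℕ, ∑' j : ℕ, (X : ℂ⟦X⟧) ^ ((i + 1) * j) =
      PowerSeries.mk fun n => if i + 1 ∣ n then 1 else 0 := by
    intro i
    have hs : Summable fun j : ℕ => (X : ℂ⟦X⟧) ^ ((i + 1) * j) := by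
      simp_rw [pow_mul]
      exact summable_pow_of_constantCoeff_eq_zero (by simp)
    ext m
    rw [hs.map_tsum _ (WithPiTopology.continuous_coeff _ _)]
    simp only [coeff_X_pow, coeff_mk]
    split_ifs with hd
    · obtain ⟨c, rfl⟩ := hd
      rw [tsum_eq_single c]
      · simp
      · intro b hb
        simp [hb.symm]
    · convert tsum_zero with j
      rw [if_neg]
      rintro rfl
      exact hd (Dvd.intro _ rfl)
  convert h4 using 2
  · refine congrArg _ (Finset.prod_congr rfl fun i _ => ?_)
    simp [overFactor, e1, Finset.sum_range_succ]
  · rw [coeff_mul, Finset.Nat.sum_antidiagonal_eq_sum_range_succ_mk]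
    simp [pbar, Nat.Partition.countRestricted_two, Nat.Partition.restricted]

lemma PowerSeries.hasSum_coeff_mul {A B : PowerSeries ℂ} {q a b : ℂ}
    (hA : HasSum (fun n => PowerSeries.coeff n A * q ^ n) a)
    (hB : HasSum (fun n => PowerSeries.coeff n B * q ^ n) b) :
    HasSum (fun n => PowerSeries.coeff n (A * B) * q ^ n) (a * b) := by
  have h := summable_norm_sum_mul_antidiagonal_of_summable_norm hA.summable.norm hB.summable.norm
  have h2 := tsum_mul_tsum_eq_tsum_sum_antidiagonal_of_summable_norm hA.summable.norm
    hB.summable.norm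
  rw [hA.tsum_eq, hB.tsum_eq] at h2
  rw [h2]
  refine h.of_norm.hasSum.congr_fun fun n => ?_
  rw [PowerSeries.coeff_mul, Finset.sum_mul]
  refine Finset.sum_congr rfl fun p hp => ?_
  rw [← Finset.HasAntidiagonal.mem_antidiagonal.mp hp, pow_add]
  ring

/-- The function represented by `overFactor i`. -/
lemma hasSum_overFactor (i : ℕ) {q : ℂ} (hq : ‖q‖ < 1) :
    HasSum (fun n => PowerSeries.coeff n (overFactor i) * q ^ n)
      ((1 + q ^ (i + 1)) / (1 - q ^ (i + 1))) := by
  rw [div_eq_mul_inv]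
  refine PowerSeries.hasSum_coeff_mul ?_ ?_
  · refine ((hasSum_ite_eq 0 (1 : ℂ)).add (hasSum_ite_eq (i + 1) (q ^ (i + 1)))).congr_fun
      fun n => ?_
    simp only [map_add, PowerSeries.coeff_one, PowerSeries.coeff_X_pow, add_mul]
    congr 1 <;> split_ifs with h <;> simp [h]
  · have hinj : Function.Injective fun c : ℕ => (i + 1) * c :=
      fun a b h => Nat.eq_of_mul_eq_mul_left i.succ_pos h
    refine (hinj.hasSum_iff ?_).mp ?_
    · intro n hn
      have : ¬ i + 1 ∣ n := fun ⟨c, hc⟩ => hn ⟨c, hc.symm⟩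
      simp [this]
    · have hlt : ‖q ^ (i + 1)‖ < 1 := by
        rw [norm_pow]; exact pow_lt_one₀ (norm_nonneg _) hq (by simp)
      refine (hasSum_geometric_of_norm_lt_one hlt).congr_fun fun c => ?_
      simp [pow_mul]

lemma hasSum_prod_overFactor (K : ℕ) {q : ℂ} (hq : ‖q‖ < 1) :
    HasSum (fun n => PowerSeries.coeff n (∏ i ∈ Finset.range K, overFactor i) * q ^ n)
      (∏ i ∈ Finset.range K, (1 + q ^ (i + 1)) / (1 - q ^ (i + 1))) := by
  induction K with
  | zero =>
    simp only [Finset.range_zero, Finset.prod_empty, PowerSeries.coeff_one]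
    convert hasSum_ite_eq 0 (1 : ℂ) using 2 with n
    split_ifs with h <;> simp [h]
  | succ K ih =>
    rw [Finset.prod_range_succ, Finset.prod_range_succ]
    exact PowerSeries.hasSum_coeff_mul ih (hasSum_overFactor K hq)

/-- Cauchy's coefficient formula on a circle, for a power series convergent in the unit disc. -/
lemma integral_hasSum_mul_exp {a : ℕ → ℂ} {f : ℂ → ℂ} {r : ℝ} (hr0 : 0 ≤ r) (hr : r < 1)
    (hf : ∀ q : ℂ, ‖q‖ < 1 → HasSum (fun n => a n * q ^ n) (f q)) (n : ℕ) :
    ∫ θ in (-π)..π, f (r * Complex.exp (θ * Complex.I)) * Complex.exp (-(n * θ * Complex.I)) =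
      2 * π * (a n * r ^ n) := by
  have hnorm : ∀ θ : ℝ, ‖(r * Complex.exp (θ * Complex.I) : ℂ)‖ = r := fun θ => by
    rw [norm_mul, Complex.norm_exp_ofReal_mul_I, mul_one, Complex.norm_real, norm_eq_abs,
      abs_of_nonneg hr0]
  have hnorm' : ∀ θ : ℝ, ‖Complex.exp (-(n * θ * Complex.I))‖ = 1 := fun θ => by
    rw [Complex.norm_exp]; simp
  have hsum := intervalIntegral.hasSum_integral_of_dominated_convergence
    (μ := MeasureTheory.volume) (a := -π) (b := π)
    (F := fun m (θ : ℝ) => a m * (r * Complex.exp (θ * Complex.I)) ^ m *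
      Complex.exp (-(n * θ * Complex.I)))
    (f := fun θ : ℝ => f (r * Complex.exp (θ * Complex.I)) * Complex.exp (-(n * θ * Complex.I)))
    (fun m _ => ‖a m * (r : ℂ) ^ m‖) (fun m => by fun_prop)
    (fun m => .of_forall fun θ _ => by
      rw [norm_mul, norm_mul, norm_pow, hnorm, hnorm', norm_mul, norm_pow, Complex.norm_real,
        norm_eq_abs, abs_of_nonneg hr0, mul_one])
    (.of_forall fun θ _ => (hf r (by
      rwa [Complex.norm_real, norm_eq_abs, abs_of_nonneg hr0])).summable.norm)
    (by simp)
    (.of_forall fun θ _ => (hf _ (by rw [hnorm]; exact hr)).mul_right _)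
  refine hsum.unique ?_
  have hterm : ∀ m : ℕ, ∫ θ : ℝ in (-π)..π, a m * (r * Complex.exp (θ * Complex.I)) ^ m *
      Complex.exp (-(n * θ * Complex.I)) = if m = n then 2 * π * (a n * r ^ n) else 0 := by
    intro m
    have e : ∀ θ : ℝ, a m * (r * Complex.exp (θ * Complex.I)) ^ m *
        Complex.exp (-(n * θ * Complex.I)) =
        a m * r ^ m * Complex.exp (((m : ℂ) - n) * Complex.I * θ) := fun θ => by
      rw [mul_pow, ← Complex.exp_nat_mul, ← mul_assoc, mul_assoc, ← Complex.exp_add]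
      ring_nf
    simp_rw [e, intervalIntegral.integral_const_mul]
    split_ifs with h
    · subst h
      simp
      ring
    · have hc : ((m : ℂ) - n) * Complex.I ≠ 0 :=
        mul_ne_zero (sub_ne_zero.mpr (by exact_mod_cast h)) Complex.I_ne_zero
      rw [integral_exp_mul_complex hc]
      have hper : Complex.exp (((m : ℂ) - n) * Complex.I * (π : ℝ)) =
          Complex.exp (((m : ℂ) - n) * Complex.I * (-π : ℝ)) := by
        rw [Complex.exp_eq_exp_iff_exists_int]
        exact ⟨m - n, by push_cast; ring⟩
      rw [hper]
      simp
  simp_rw [hterm]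
  exact hasSum_ite_eq n _

/-! ### The logarithm of the generating function -/

/-- `logOver z = log ∏ (1 + q ^ m) / (1 - q ^ m)` at `q = exp (-z)`, as a Lambert series. -/
noncomputable def logOver (z : ℂ) : ℂ :=
  ∑' j : ℕ, 2 / (2 * j + 1 : ℂ) * (Complex.exp ((2 * j + 1 : ℂ) * z) - 1)⁻¹

lemma hasSum_log_one_add_sub_log_one_sub {w : ℂ} (hw : ‖w‖ < 1) :
    HasSum (fun j : ℕ => 2 / (2 * j + 1 : ℂ) * w ^ (2 * j + 1))
      (Complex.log (1 + w) - Complex.log (1 - w)) := by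
  have h1 := Complex.hasSum_taylorSeries_neg_log hw
  have h2 := Complex.hasSum_taylorSeries_neg_log (z := -w) (by rwa [norm_neg])
  have h3 := h1.sub h2
  rw [show -Complex.log (1 - w) - -Complex.log (1 - -w) =
    Complex.log (1 + w) - Complex.log (1 - w) by ring_nf] at h3
  have hinj : Function.Injective fun j : ℕ => 2 * j + 1 := fun a b h => by simpa using h
  refine ((hinj.hasSum_iff ?_).mpr h3).congr_fun fun j => ?_
  · intro n hn
    have he : Even n := by
      by_contra ho
      obtain ⟨c, hc⟩ := Nat.not_even_iff_odd.mp ho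
      exact hn ⟨c, hc.symm⟩
    simp [he.neg_pow]
  · have : Odd (2 * j + 1) := ⟨j, rfl⟩
    simp only [Function.comp_apply, this.neg_pow]
    push_cast
    ring

lemma exp_log_one_add_sub_log_one_sub {w : ℂ} (hw : ‖w‖ < 1) :
    Complex.exp (Complex.log (1 + w) - Complex.log (1 - w)) = (1 + w) / (1 - w) := by
  rw [Complex.exp_sub, Complex.exp_log, Complex.exp_log]
  · intro h
    rw [sub_eq_zero] at h
    simp [← h] at hw
  · intro h
    rw [← eq_neg_iff_add_eq_zero] at h
    rw [← norm_neg, ← h] at hw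
    simp at hw

lemma norm_exp_neg_lt_one {z : ℂ} (hz : 0 < z.re) : ‖Complex.exp (-z)‖ < 1 := by
  rw [Complex.norm_exp]; simpa using hz

lemma norm_lambert_term_le {q : ℂ} (hq : ‖q‖ < 1) (i j : ℕ) :
    ‖2 / (2 * j + 1 : ℂ) * (q ^ (i + 1)) ^ (2 * j + 1)‖ ≤ 2 * (‖q‖ ^ i * ‖q‖ ^ j) := by
  rw [norm_mul, norm_pow, norm_pow, ← pow_mul, ← pow_add, norm_div]
  have h1 : ‖(2 * j + 1 : ℂ)‖ = 2 * j + 1 := by exact_mod_cast Complex.norm_natCast (2 * j + 1)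
  have h2 : ‖(2 : ℂ)‖ / ‖(2 * j + 1 : ℂ)‖ ≤ 2 := by
    rw [h1]
    simp only [Complex.norm_ofNat]
    rw [div_le_iff₀ (by positivity)]
    nlinarith [(Nat.cast_nonneg j : (0 : ℝ) ≤ j)]
  have h3 : ‖q‖ ^ ((i + 1) * (2 * j + 1)) ≤ ‖q‖ ^ (i + j) :=
    pow_le_pow_of_le_one (norm_nonneg _) hq.le (by nlinarith)
  exact mul_le_mul h2 h3 (by positivity) (by norm_num)

lemma summable_lambert {q : ℂ} (hq : ‖q‖ < 1) :
    Summable fun p : ℕ × ℕ => 2 / (2 * p.2 + 1 : ℂ) * (q ^ (p.1 + 1)) ^ (2 * p.2 + 1) := by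
  have hg := summable_geometric_of_lt_one (norm_nonneg q) hq
  have h := (hg.mul_of_nonneg hg (fun _ => by positivity) (fun _ => by positivity)).mul_left 2
  exact .of_norm_bounded h fun p => norm_lambert_term_le hq p.1 p.2

lemma hasSum_pow_succ_pow {z : ℂ} (hz : 0 < z.re) (j : ℕ) :
    HasSum (fun i : ℕ => (Complex.exp (-z) ^ (i + 1)) ^ (2 * j + 1))
      (Complex.exp ((2 * j + 1 : ℂ) * z) - 1)⁻¹ := by
  have hq := norm_exp_neg_lt_one hz
  set Q := Complex.exp (-z) ^ (2 * j + 1) with hQ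
  have hlt : ‖Q‖ < 1 := by
    rw [norm_pow]; exact pow_lt_one₀ (norm_nonneg _) hq (by simp)
  have hQe : Complex.exp ((2 * j + 1 : ℂ) * z) = Q⁻¹ := by
    rw [hQ, ← Complex.exp_nat_mul, ← Complex.exp_neg]
    push_cast
    ring_nf
  have hQ0 : Q ≠ 0 := pow_ne_zero _ (Complex.exp_ne_zero _)
  have h1 : 1 - Q ≠ 0 := by
    intro h
    rw [sub_eq_zero] at h
    simp [← h] at hlt
  have h2 : Q⁻¹ - 1 ≠ 0 := by
    rw [show Q⁻¹ - 1 = Q⁻¹ * (1 - Q) by field_simp]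
    exact mul_ne_zero (inv_ne_zero hQ0) h1
  have e : (Complex.exp ((2 * j + 1 : ℂ) * z) - 1)⁻¹ = (1 - Q)⁻¹ * Q := by
    rw [hQe]
    field_simp
  rw [e]
  refine ((hasSum_geometric_of_norm_lt_one hlt).mul_right Q).congr_fun fun i => ?_
  rw [← pow_succ, hQ, ← pow_mul, ← pow_mul, mul_comm]

lemma hasSum_iterated {f : ℕ → ℕ → ℂ} {g h : ℕ → ℂ} {a : ℂ}
    (hs : Summable fun p : ℕ × ℕ => f p.1 p.2) (hg : ∀ i, HasSum (fun j => f i j) (g i))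
    (hh : ∀ j, HasSum (fun i => f i j) (h j)) (ha : ∑' j, h j = a) : HasSum g a := by
  have h1 : HasSum g (∑' p : ℕ × ℕ, f p.1 p.2) := hs.hasSum.prod_fiberwise hg
  have hs' : Summable fun p : ℕ × ℕ => f p.2 p.1 := hs.prod_symm
  have h2 : HasSum h (∑' p : ℕ × ℕ, f p.2 p.1) := hs'.hasSum.prod_fiberwise hh
  rw [h2.tsum_eq] at ha
  rw [← ha]
  convert h1 using 1
  exact (Equiv.prodComm ℕ ℕ).tsum_eq (fun p : ℕ × ℕ => f p.1 p.2)

lemma hasSum_logOver {z : ℂ} (hz : 0 < z.re) :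
    HasSum (fun i : ℕ => Complex.log (1 + Complex.exp (-z) ^ (i + 1)) -
      Complex.log (1 - Complex.exp (-z) ^ (i + 1))) (logOver z) := by
  have hq : ‖Complex.exp (-z)‖ < 1 := norm_exp_neg_lt_one hz
  generalize hf : (fun i j : ℕ => 2 / (2 * j + 1 : ℂ) *
    (Complex.exp (-z) ^ (i + 1)) ^ (2 * j + 1)) = f
  have hf' : ∀ i j : ℕ, 2 / (2 * j + 1 : ℂ) * (Complex.exp (-z) ^ (i + 1)) ^ (2 * j + 1) =
    f i j := fun i j => congrFun (congrFun hf i) j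
  have h1 := summable_lambert hq
  simp only [hf'] at h1
  refine hasSum_iterated h1 (fun i => ?_) (fun j => ?_) rfl
  · have h2 := hasSum_log_one_add_sub_log_one_sub (w := Complex.exp (-z) ^ (i + 1)) (by
      rw [norm_pow]; exact pow_lt_one₀ (norm_nonneg _) hq (by simp))
    simpa only [hf'] using h2
  · have h3 := (hasSum_pow_succ_pow hz j).mul_left (2 / (2 * j + 1 : ℂ))
    simpa only [hf'] using h3

lemma tendsto_prod_exp_logOver {z : ℂ} (hz : 0 < z.re) :
    Tendsto (fun K => ∏ i ∈ Finset.range K,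
      (1 + Complex.exp (-z) ^ (i + 1)) / (1 - Complex.exp (-z) ^ (i + 1))) atTop
      (𝓝 (Complex.exp (logOver z))) := by
  refine ((Complex.continuous_exp.tendsto _).comp (hasSum_logOver hz).tendsto_sum_nat).congr
    fun K => ?_
  rw [Function.comp_apply, Complex.exp_sum]
  exact Finset.prod_congr rfl fun i _ => exp_log_one_add_sub_log_one_sub (by
    rw [norm_pow]; exact pow_lt_one₀ (norm_nonneg _) (norm_exp_neg_lt_one hz) (by simp))

lemma exists_norm_prod_le {r : ℝ} (hr0 : 0 ≤ r) (hr : r < 1) :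
    ∃ C : ℝ, ∀ (K : ℕ) (q : ℂ), ‖q‖ = r →
      ‖∏ i ∈ Finset.range K, (1 + q ^ (i + 1)) / (1 - q ^ (i + 1))‖ ≤ C := by
  refine ⟨rexp (∑' i : ℕ, r ^ i * (2 * ∑' j : ℕ, r ^ j)), fun K q hqr => ?_⟩
  have hq : ‖q‖ < 1 := hqr ▸ hr
  have hqi : ∀ i : ℕ, ‖q ^ (i + 1)‖ < 1 := fun i => by
    rw [norm_pow]; exact pow_lt_one₀ (norm_nonneg _) hq (by simp)
  have hg := summable_geometric_of_lt_one hr0 hr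
  have hle : ∀ i, ‖Complex.log (1 + q ^ (i + 1)) - Complex.log (1 - q ^ (i + 1))‖ ≤
      r ^ i * (2 * ∑' j : ℕ, r ^ j) := fun i => by
    rw [← (hasSum_log_one_add_sub_log_one_sub (hqi i)).tsum_eq]
    refine tsum_of_norm_bounded (hg.hasSum.mul_left (2 : ℝ) |>.mul_left (r ^ i)) fun j => ?_
    rw [← hqr]
    exact (norm_lambert_term_le hq i j).trans_eq (by ring)
  calc ‖∏ i ∈ Finset.range K, (1 + q ^ (i + 1)) / (1 - q ^ (i + 1))‖
      = ‖Complex.exp (∑ i ∈ Finset.range K,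
          (Complex.log (1 + q ^ (i + 1)) - Complex.log (1 - q ^ (i + 1))))‖ := by
        rw [Complex.exp_sum]
        exact congrArg _ (Finset.prod_congr rfl fun i _ =>
          (exp_log_one_add_sub_log_one_sub (hqi i)).symm)
    _ ≤ rexp ‖∑ i ∈ Finset.range K,
          (Complex.log (1 + q ^ (i + 1)) - Complex.log (1 - q ^ (i + 1)))‖ :=
        Complex.norm_exp_le_exp_norm _
    _ ≤ rexp (∑ i ∈ Finset.range K, r ^ i * (2 * ∑' j : ℕ, r ^ j)) :=
        Real.exp_le_exp.mpr (norm_sum_le_of_le _ fun i _ => hle i)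
    _ ≤ _ := Real.exp_le_exp.mpr ((hg.mul_right _).sum_le_tsum _ fun i _ => by positivity)

/-- The coefficient integral for overpartitions. -/
lemma integral_exp_logOver (n : ℕ) {x : ℝ} (hx : 0 < x) :
    ∫ θ in (-π)..π, Complex.exp (logOver (x - θ * Complex.I)) *
      Complex.exp (-(n * θ * Complex.I)) = 2 * π * (pbar n * Complex.exp (-x) ^ n) := by
  set r := rexp (-x) with hr
  have hr0 : 0 ≤ r := (Real.exp_pos _).le
  have hr1 : r < 1 := by rw [hr, Real.exp_lt_one_iff]; linarith
  have hqe : ∀ θ : ℝ, (r * Complex.exp (θ * Complex.I) : ℂ) =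
      Complex.exp (-(x - θ * Complex.I)) := fun θ => by
    rw [hr, Complex.ofReal_exp, ← Complex.exp_add]
    push_cast
    ring_nf
  have hre : ∀ θ : ℝ, 0 < (x - θ * Complex.I : ℂ).re := fun θ => by simpa using hx
  obtain ⟨C, hC⟩ := exists_norm_prod_le hr0 hr1
  have hlim : Tendsto (fun K => ∫ θ in (-π)..π, (∏ i ∈ Finset.range K,
      (1 + (r * Complex.exp (θ * Complex.I)) ^ (i + 1)) /
        (1 - (r * Complex.exp (θ * Complex.I)) ^ (i + 1))) *
      Complex.exp (-(n * θ * Complex.I))) atTop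
      (𝓝 (∫ θ in (-π)..π, Complex.exp (logOver (x - θ * Complex.I)) *
      Complex.exp (-(n * θ * Complex.I)))) := by
    refine intervalIntegral.tendsto_integral_filter_of_dominated_convergence (fun _ => C)
      (.of_forall fun K => ?_) (.of_forall fun K => .of_forall fun θ _ => ?_) (by simp)
      (.of_forall fun θ _ => ?_)
    · exact (by fun_prop : Measurable _).aestronglyMeasurable
    · rw [norm_mul, Complex.norm_exp (-_)]
      simp only [Complex.neg_re, Complex.mul_re, Complex.natCast_re, Complex.ofReal_re,
        Complex.natCast_im, Complex.ofReal_im, Complex.I_re, Complex.I_im, Complex.mul_im]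
      simp only [mul_zero, sub_zero, zero_mul, add_zero, mul_one, neg_zero, Real.exp_zero]
      refine hC K _ ?_
      rw [norm_mul, Complex.norm_exp_ofReal_mul_I, mul_one, Complex.norm_real, norm_eq_abs,
        abs_of_nonneg hr0]
    · simp_rw [hqe]
      exact (tendsto_prod_exp_logOver (hre θ)).mul_const _
  refine tendsto_nhds_unique hlim ?_
  have hK : ∀ K, _ := fun K => integral_hasSum_mul_exp hr0 hr1
    (fun q hq => hasSum_prod_overFactor K hq) n
  simp_rw [hK]
  have := ((tendsto_coeff_prod_overFactor n).mul_const ((r : ℂ) ^ n)).const_mul (2 * π : ℂ)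
  convert this using 4
  simp [hr]

lemma hasSum_one_div_odd_sq :
    HasSum (fun j : ℕ => 1 / (2 * j + 1 : ℝ) ^ 2) (π ^ 2 / 8) := by
  have h := hasSum_zeta_two
  have hodd : Summable fun j : ℕ => 1 / ((2 * j + 1 : ℕ) : ℝ) ^ 2 :=
    h.summable.comp_injective (i := fun j : ℕ => 2 * j + 1) fun a b h => by simpa using h
  have heven : HasSum (fun j : ℕ => 1 / ((2 * j : ℕ) : ℝ) ^ 2) (1 / 4 * (π ^ 2 / 6)) :=
    (h.mul_left (1 / 4)).congr_fun fun j => by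
      push_cast
      rw [mul_pow, one_div_mul_one_div]
      norm_num
  have h2 := (heven.even_add_odd (f := fun n : ℕ => 1 / (n : ℝ) ^ 2) hodd.hasSum).unique h
  have h3 := hodd.hasSum
  rw [show ∑' j : ℕ, 1 / ((2 * j + 1 : ℕ) : ℝ) ^ 2 = π ^ 2 / 8 by linarith] at h3
  exact_mod_cast h3

lemma exp_re_sub_one_le_norm (w : ℂ) : rexp w.re - 1 ≤ ‖Complex.exp w - 1‖ := by
  have := norm_sub_norm_le (Complex.exp w) 1
  rwa [Complex.norm_exp, norm_one] at this

lemma re_le_norm_exp_sub_one (w : ℂ) : w.re ≤ ‖Complex.exp w - 1‖ := by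
  linarith [exp_re_sub_one_le_norm w, Real.add_one_le_exp w.re]

lemma exp_sub_one_ne_zero {w : ℂ} (hw : 0 < w.re) : Complex.exp w - 1 ≠ 0 := by
  rw [← norm_pos_iff]
  exact hw.trans_le (re_le_norm_exp_sub_one w)

lemma re_odd_mul (j : ℕ) (z : ℂ) : ((2 * j + 1 : ℂ) * z).re = (2 * j + 1) * z.re := by
  simp [Complex.mul_re, Complex.add_im, Complex.mul_im]

lemma summable_logOver {z : ℂ} (hz : 0 < z.re) :
    Summable fun j : ℕ => 2 / (2 * j + 1 : ℂ) * (Complex.exp ((2 * j + 1 : ℂ) * z) - 1)⁻¹ := by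
  refine .of_norm_bounded (hasSum_one_div_odd_sq.summable.mul_left (2 / z.re)) fun j => ?_
  have h1 : ‖(2 * j + 1 : ℂ)‖ = 2 * j + 1 := by exact_mod_cast Complex.norm_natCast (2 * j + 1)
  have h2 := re_le_norm_exp_sub_one ((2 * j + 1 : ℂ) * z)
  rw [re_odd_mul] at h2
  rw [norm_mul, norm_div, norm_inv, h1, Complex.norm_ofNat]
  have h3 : 0 < (2 * j + 1) * z.re := by positivity
  calc 2 / (2 * j + 1 : ℝ) * ‖Complex.exp ((2 * j + 1 : ℂ) * z) - 1‖⁻¹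
      ≤ 2 / (2 * j + 1 : ℝ) * ((2 * j + 1) * z.re)⁻¹ := by gcongr
    _ = _ := by field_simp

lemma logOver_ofReal_im (x : ℝ) : (logOver x).im = 0 := by
  have : logOver x =
      ((∑' j : ℕ, 2 / (2 * j + 1 : ℝ) * (rexp ((2 * j + 1) * x) - 1)⁻¹ : ℝ) : ℂ) := by
    rw [logOver, Complex.ofReal_tsum]
    push_cast
    rfl
  rw [this, Complex.ofReal_im]

lemma ofReal_logOver_re (x : ℝ) : ((logOver x).re : ℂ) = logOver x :=
  Complex.ext rfl (by rw [logOver_ofReal_im, Complex.ofReal_im])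

lemma re_inv_exp_sub_one_ofReal (u : ℝ) : (Complex.exp u - 1)⁻¹.re = (rexp u - 1)⁻¹ := by
  rw [← Complex.ofReal_exp, ← Complex.ofReal_one, ← Complex.ofReal_sub, ← Complex.ofReal_inv,
    Complex.ofReal_re]

lemma re_inv_exp_sub_one_le {w : ℂ} (hw : 0 < w.re) :
    (Complex.exp w - 1)⁻¹.re ≤ (rexp w.re - 1)⁻¹ := by
  refine (Complex.re_le_norm _).trans ?_
  rw [norm_inv]
  have : 0 < rexp w.re - 1 := by linarith [Real.add_one_le_exp w.re]
  exact inv_anti₀ this (exp_re_sub_one_le_norm w)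

lemma hasSum_re_logOver {z : ℂ} (hz : 0 < z.re) :
    HasSum (fun j : ℕ => 2 / (2 * j + 1 : ℝ) * (Complex.exp ((2 * j + 1 : ℂ) * z) - 1)⁻¹.re)
      (logOver z).re := by
  refine (Complex.hasSum_re (summable_logOver hz).hasSum).congr_fun fun j => ?_
  rw [← Complex.re_ofReal_mul]
  push_cast
  rfl

lemma re_logOver_sub_le {z : ℂ} (hz : 0 < z.re) :
    (logOver z).re - (logOver z.re).re ≤
      2 * ((Complex.exp z - 1)⁻¹.re - (rexp z.re - 1)⁻¹) := by
  have h := (hasSum_re_logOver hz).sub (hasSum_re_logOver (z := (z.re : ℂ)) hz)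
  have hle : ∀ j : ℕ, j ≠ 0 →
      2 / (2 * j + 1 : ℝ) * (Complex.exp ((2 * j + 1 : ℂ) * z) - 1)⁻¹.re -
      2 / (2 * j + 1 : ℝ) * (Complex.exp ((2 * j + 1 : ℂ) * (z.re : ℂ)) - 1)⁻¹.re ≤ 0 := by
    intro j _
    have h1 : 0 < ((2 * j + 1 : ℂ) * z).re := by rw [re_odd_mul]; positivity
    have h2 := re_inv_exp_sub_one_le h1
    have h3 : (2 * j + 1 : ℂ) * (z.re : ℂ) = (((2 * j + 1 : ℂ) * z).re : ℂ) := by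
      rw [re_odd_mul]; push_cast; rfl
    rw [h3, re_inv_exp_sub_one_ofReal, ← mul_sub]
    exact mul_nonpos_of_nonneg_of_nonpos (by positivity) (by linarith)
  rw [← h.tsum_eq]
  have h4 := (h.summable.neg).le_tsum 0 fun j hj => neg_nonneg.mpr (hle j hj)
  rw [tsum_neg, neg_le_neg_iff] at h4
  refine h4.trans_eq ?_
  simp only [CharP.cast_eq_zero, mul_zero, zero_add, div_one, one_mul]
  rw [re_inv_exp_sub_one_ofReal]
  ring

lemma re_logOver_decay {x θ : ℝ} (hx : 0 < x) (hx1 : x ≤ 1) (hθ : |θ| ≤ π) :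
    (logOver (x - θ * Complex.I)).re - (logOver x).re ≤ -(θ ^ 2 / (10 * x * (x ^ 2 + θ ^ 2))) := by
  have hre : (x - θ * Complex.I : ℂ).re = x := by simp
  have him : (x - θ * Complex.I : ℂ).im = -θ := by simp
  have h := re_logOver_sub_le (z := x - θ * Complex.I) (by rw [hre]; exact hx)
  rw [hre] at h
  refine h.trans ?_
  set E := rexp x with hE
  have hE1 : 1 + x ≤ E := by linarith [Real.add_one_le_exp x]
  have hE2 : E - 1 ≤ 2 * x := by
    have := Real.abs_exp_sub_one_sub_id_le (x := x) (by rw [abs_of_pos hx]; exact hx1)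
    have := (abs_le.mp this).2
    nlinarith
  set t := E * (1 - cos θ) with ht
  have ht1 : θ ^ 2 / 5 ≤ t := by
    have h1 := Real.cos_le_one_sub_mul_cos_sq hθ
    have h2 : π ^ 2 < 10 := by nlinarith [Real.pi_lt_d2, Real.pi_pos]
    have h3 : 1 / 5 ≤ 2 / π ^ 2 := by
      rw [div_le_div_iff₀ (by norm_num) (by positivity)]; linarith
    have h4 : θ ^ 2 / 5 ≤ 1 - cos θ := by nlinarith [sq_nonneg θ]
    nlinarith [sq_nonneg θ]
  set a := E - 1 with ha
  have ha0 : 0 < a := by linarith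
  have ht0 : 0 ≤ t := le_trans (by positivity) ht1
  have hcalc : (Complex.exp (x - θ * Complex.I) - 1)⁻¹.re = (a - t) / (a ^ 2 + 2 * t) := by
    rw [Complex.inv_re, Complex.normSq_apply]
    simp only [Complex.sub_re, Complex.sub_im, Complex.one_re, Complex.one_im, Complex.exp_re,
      Complex.exp_im, hre, him, cos_neg, sin_neg]
    congr 1
    · rw [ha, ht]; ring
    · rw [ha, ht, ← hE]; nlinarith [Real.sin_sq_add_cos_sq θ]
  rw [hcalc]
  have e1 : 2 * ((a - t) / (a ^ 2 + 2 * t) - a⁻¹) = -(2 * t * (2 + a) / (a * (a ^ 2 + 2 * t))) := by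
    field_simp
    ring
  rw [e1, neg_le_neg_iff, div_le_div_iff₀ (by positivity) (by positivity)]
  have h5 : a * (a ^ 2 + 2 * t) ≤ 2 * x * (4 * x ^ 2 + 2 * t) := by
    have : a ^ 2 ≤ 4 * x ^ 2 := by nlinarith
    gcongr
  calc θ ^ 2 * (a * (a ^ 2 + 2 * t)) ≤ θ ^ 2 * (2 * x * (4 * x ^ 2 + 2 * t)) := by gcongr
    _ ≤ 2 * t * 2 * (10 * x * (x ^ 2 + θ ^ 2)) := by
      have : 0 ≤ x * x ^ 2 * (5 * t - θ ^ 2) := mul_nonneg (by positivity) (by linarith)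
      have : 0 ≤ x * t * θ ^ 2 := by positivity
      nlinarith
    _ ≤ 2 * t * (2 + a) * (10 * x * (x ^ 2 + θ ^ 2)) := by gcongr; linarith

/-! ### The regular part of `1 / (exp z - 1)` -/

/-- `1 / (exp z - 1)` with its pole at the origin removed. -/
noncomputable def bosePart (z : ℂ) : ℂ := (Complex.exp z - 1)⁻¹ - z⁻¹

lemma hasDerivAt_bosePart {z : ℂ} (hz : 0 < z.re) :
    HasDerivAt bosePart ((z ^ 2)⁻¹ - Complex.exp z / (Complex.exp z - 1) ^ 2) z := by
  have hz0 : z ≠ 0 := by rintro rfl; simp at hz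
  have h := (((Complex.hasDerivAt_exp z).sub_const 1).inv (exp_sub_one_ne_zero hz)).sub
    (hasDerivAt_inv hz0)
  exact h.congr_deriv (by ring)

lemma norm_sq_le_two_mul_re_sq {z : ℂ} (hz : |z.im| ≤ z.re) : ‖z‖ ^ 2 ≤ 2 * z.re ^ 2 := by
  rw [Complex.sq_norm, Complex.normSq_apply]
  have := abs_le.mp hz
  nlinarith

lemma norm_deriv_bosePart_le_inv_sq {z : ℂ} (hz : 0 < z.re) :
    ‖(z ^ 2)⁻¹ - Complex.exp z / (Complex.exp z - 1) ^ 2‖ ≤ 2 / z.re ^ 2 := by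
  set u := z.re with hu
  have h1 : ‖(z ^ 2)⁻¹‖ ≤ 1 / u ^ 2 := by
    rw [norm_inv, norm_pow, one_div]
    have := (le_abs_self _).trans (Complex.abs_re_le_norm z)
    gcongr
  have h2 : ‖Complex.exp z / (Complex.exp z - 1) ^ 2‖ ≤ 1 / u ^ 2 := by
    rw [norm_div, norm_pow, Complex.norm_exp, ← hu]
    have h3 := exp_re_sub_one_le_norm z
    rw [← hu] at h3
    have h5 : u ≤ 2 * sinh (u / 2) := by
      have := Real.self_le_sinh_iff.mpr (by positivity : 0 ≤ u / 2)
      linarith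
    rw [Real.sinh_eq] at h5
    have hp : rexp u = rexp (u / 2) ^ 2 := by rw [← Real.exp_nat_mul]; ring_nf
    have hm : rexp (u / 2) * rexp (-(u / 2)) = 1 := by rw [← Real.exp_add]; simp
    have h4 : u * rexp (u / 2) ≤ rexp u - 1 := by
      rw [hp]; nlinarith [Real.exp_pos (u / 2)]
    have h6 : 0 < u * rexp (u / 2) := by positivity
    rw [div_le_div_iff₀ (by have := h6.trans_le (h4.trans h3); positivity) (by positivity)]
    calc rexp u * u ^ 2 = (u * rexp (u / 2)) ^ 2 := by rw [hp]; ring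
      _ ≤ ‖Complex.exp z - 1‖ ^ 2 := by gcongr; exact h4.trans h3
      _ = _ := by ring
  refine (norm_sub_le _ _).trans ((add_le_add h1 h2).trans_eq (by ring))

lemma norm_two_sinh_half_sub_le {z : ℂ} (hz : ‖z‖ ≤ 1) :
    ‖Complex.exp (z / 2) - Complex.exp (-(z / 2)) - z‖ ≤ ‖z‖ ^ 3 := by
  have hn : ‖z / 2‖ = ‖z‖ / 2 := by simp
  have h1 := Complex.exp_bound (x := z / 2) (by rw [hn]; linarith) (n := 3) (by norm_num)
  have h2 := Complex.exp_bound (x := -(z / 2)) (by rw [norm_neg, hn]; linarith) (n := 3)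
    (by norm_num)
  rw [norm_neg] at h2
  rw [hn] at h1 h2
  norm_num [Finset.sum_range_succ, Nat.factorial] at h1 h2
  have h3 := (norm_sub_le _ _).trans (add_le_add h1 h2)
  refine (le_of_eq ?_).trans (h3.trans ?_)
  · congr 1; ring
  · nlinarith [pow_nonneg (norm_nonneg z) 3]

lemma norm_deriv_bosePart_le_const {z : ℂ} (hz : 0 < z.re) (him : |z.im| ≤ z.re) :
    ‖(z ^ 2)⁻¹ - Complex.exp z / (Complex.exp z - 1) ^ 2‖ ≤ 40 := by
  rcases le_or_gt (1 / 2) z.re with h | h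
  · refine (norm_deriv_bosePart_le_inv_sq hz).trans ?_
    rw [div_le_iff₀ (by positivity)]
    nlinarith
  have hsq := norm_sq_le_two_mul_re_sq him
  have hn1 : ‖z‖ ≤ 1 := by nlinarith [norm_nonneg z]
  have hz0 : z ≠ 0 := by rintro rfl; simp at hz
  have he := exp_sub_one_ne_zero hz
  set S := Complex.exp (z / 2) - Complex.exp (-(z / 2)) with hS
  have hSe : S * Complex.exp (z / 2) = Complex.exp z - 1 := by
    rw [hS, sub_mul, ← Complex.exp_add, ← Complex.exp_add]
    rw [add_halves, neg_add_cancel, Complex.exp_zero]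
  have hp : Complex.exp z = Complex.exp (z / 2) ^ 2 := by rw [← Complex.exp_nat_mul]; ring_nf
  have hE0 := Complex.exp_ne_zero (z / 2)
  have hS0 : S ≠ 0 := by rintro h0; rw [h0, zero_mul] at hSe; exact he hSe.symm
  have e1 : (z ^ 2)⁻¹ - Complex.exp z / (Complex.exp z - 1) ^ 2 =
      (S - z) * (S + z) * Complex.exp z / (z ^ 2 * (Complex.exp z - 1) ^ 2) := by
    rw [← hSe, hp]
    field_simp
    ring
  have hb := norm_two_sinh_half_sub_le hn1
  rw [← hS] at hb
  have hb2 : ‖S + z‖ ≤ 3 * ‖z‖ := by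
    have : S + z = (S - z) + 2 * z := by ring
    rw [this]
    refine (norm_add_le _ _).trans ?_
    rw [norm_mul, Complex.norm_ofNat]
    nlinarith [norm_nonneg z, mul_le_one₀ hn1 (norm_nonneg z) hn1]
  have hexp : ‖Complex.exp z‖ ≤ 3 := by
    rw [Complex.norm_exp]
    refine (Real.exp_le_exp.mpr (by linarith : z.re ≤ 1)).trans ?_
    linarith [Real.exp_one_lt_d9]
  have hden : ‖z‖ ^ 2 / 2 ≤ ‖Complex.exp z - 1‖ ^ 2 := by
    have := re_le_norm_exp_sub_one z
    nlinarith
  have hz' : 0 < ‖z‖ := norm_pos_iff.mpr hz0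
  rw [e1, norm_div, norm_mul, norm_mul, norm_mul, norm_pow, norm_pow,
    div_le_iff₀ (by have := norm_pos_iff.mpr he; positivity)]
  calc ‖S - z‖ * ‖S + z‖ * ‖Complex.exp z‖ ≤ ‖z‖ ^ 3 * (3 * ‖z‖) * 3 := by gcongr
    _ ≤ 40 * (‖z‖ ^ 2 * (‖z‖ ^ 2 / 2)) := by nlinarith [pow_pos hz' 4]
    _ ≤ _ := by gcongr

lemma norm_deriv_bosePart_le {z : ℂ} (hz : 0 < z.re) (him : |z.im| ≤ z.re) :
    ‖(z ^ 2)⁻¹ - Complex.exp z / (Complex.exp z - 1) ^ 2‖ ≤ 40 * z.re ^ (-(5 / 4) : ℝ) := by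
  rcases le_or_gt z.re 1 with h | h
  · refine (norm_deriv_bosePart_le_const hz him).trans ?_
    have := Real.one_le_rpow_of_pos_of_le_one_of_nonpos hz h (by norm_num : (-(5 / 4) : ℝ) ≤ 0)
    linarith
  · refine (norm_deriv_bosePart_le_inv_sq hz).trans ?_
    have h1 : z.re ^ (-2 : ℝ) ≤ z.re ^ (-(5 / 4) : ℝ) :=
      Real.rpow_le_rpow_of_exponent_le h.le (by norm_num)
    have h2 : z.re ^ (-2 : ℝ) = (z.re ^ 2)⁻¹ := by
      rw [Real.rpow_neg hz.le]; norm_num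
    rw [h2] at h1
    rw [div_eq_mul_inv]
    have : 0 < (z.re ^ 2)⁻¹ := by positivity
    linarith

lemma norm_bosePart_sub_le {x θ : ℝ} (hx : 0 < x) (hθ : |θ| ≤ x) :
    ‖bosePart (x - θ * Complex.I) - bosePart x‖ ≤ 40 * x ^ (-(5 / 4) : ℝ) * |θ| := by
  have hre : ∀ s : ℝ, (x - s * θ * Complex.I : ℂ).re = x := fun s => by simp
  have him : ∀ s : ℝ, (x - s * θ * Complex.I : ℂ).im = -(s * θ) := fun s => by simp
  have hd : ∀ s ∈ Set.Icc (0 : ℝ) 1, HasDerivWithinAt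
      (fun s : ℝ => bosePart (x - s * θ * Complex.I))
      ((((x - s * θ * Complex.I : ℂ) ^ 2)⁻¹ - Complex.exp (x - s * θ * Complex.I) /
        (Complex.exp (x - s * θ * Complex.I) - 1) ^ 2) * (-(θ * Complex.I))) (Set.Icc 0 1) s := by
    intro s _
    have h1 := hasDerivAt_bosePart (z := x - s * θ * Complex.I) (by rw [hre]; exact hx)
    have h2 : HasDerivAt (fun s : ℝ => (x - s * θ * Complex.I : ℂ)) (-(θ * Complex.I)) s := by
      have := ((Complex.ofRealCLM.hasDerivAt (x := s)).mul_const (θ * Complex.I : ℂ)).const_sub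
        (x : ℂ)
      simpa [mul_assoc] using this
    exact (h1.comp_of_eq s h2 rfl).hasDerivWithinAt
  have h := (convex_Icc (0 : ℝ) 1).norm_image_sub_le_of_norm_hasDerivWithin_le
    (C := 40 * x ^ (-(5 / 4) : ℝ) * |θ|) hd (fun s hs => ?_)
    (Set.left_mem_Icc.mpr zero_le_one) (Set.right_mem_Icc.mpr zero_le_one)
  · simpa using h
  · have h3 := norm_deriv_bosePart_le (z := x - s * θ * Complex.I) (by rw [hre]; exact hx) (by
      rw [hre, him, abs_neg, abs_mul, abs_of_nonneg hs.1]
      exact (mul_le_of_le_one_left (abs_nonneg _) hs.2).trans hθ)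
    rw [hre] at h3
    rw [norm_mul]
    refine (mul_le_mul_of_nonneg_right h3 (norm_nonneg _)).trans_eq ?_
    simp

/-! ### Local behaviour at the saddle point -/

lemma summable_odd_rpow {p : ℝ} (hp : p < -1) : Summable fun j : ℕ => (2 * j + 1 : ℝ) ^ p := by
  have h := (Real.summable_nat_rpow.mpr hp).comp_injective (i := fun j : ℕ => 2 * j + 1)
    fun a b h => by simpa using h
  exact_mod_cast h

lemma exists_norm_logOver_sub_le :
    ∃ C : ℝ, ∀ x θ : ℝ, 0 < x → |θ| ≤ x →
      ‖logOver (x - θ * Complex.I) - logOver x -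
        (π : ℂ) ^ 2 / 4 * ((x - θ * Complex.I : ℂ)⁻¹ - (x : ℂ)⁻¹)‖ ≤
        C * x ^ (-(5 / 4) : ℝ) * |θ| := by
  have hsum := (summable_odd_rpow (p := -(5 / 4)) (by norm_num)).hasSum
  refine ⟨80 * ∑' j : ℕ, (2 * j + 1 : ℝ) ^ (-(5 / 4) : ℝ), fun x θ hx hθ => ?_⟩
  have hz : 0 < (x - θ * Complex.I : ℂ).re := by simpa using hx
  have hx0 : (x : ℂ) ≠ 0 := by exact_mod_cast hx.ne'
  have hz0 : (x - θ * Complex.I : ℂ) ≠ 0 := by rintro h; simp [h] at hz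
  have h1 := (summable_logOver hz).hasSum.sub
    (summable_logOver (z := (x : ℂ)) (by simpa using hx)).hasSum
  have h2 := ((Complex.hasSum_ofReal.mpr hasSum_one_div_odd_sq).mul_left 2).mul_right
    ((x - θ * Complex.I : ℂ)⁻¹ - (x : ℂ)⁻¹)
  have h3 := h1.sub h2
  have e : (2 : ℂ) * ((π ^ 2 / 8 : ℝ) : ℂ) = (π : ℂ) ^ 2 / 4 := by push_cast; ring
  rw [e] at h3
  rw [logOver, logOver, ← h3.tsum_eq]
  refine (tsum_of_norm_bounded (hsum.mul_left (80 * x ^ (-(5 / 4) : ℝ) * |θ|)) fun j => ?_).trans_eq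
    (by ring)
  have hk : (0 : ℝ) < 2 * j + 1 := by positivity
  have hk0 : (2 * j + 1 : ℂ) ≠ 0 := by exact_mod_cast hk.ne'
  have hn : ‖(2 * j + 1 : ℂ)‖ = 2 * j + 1 := by exact_mod_cast Complex.norm_natCast (2 * j + 1)
  have h4 := norm_bosePart_sub_le (x := (2 * j + 1) * x) (θ := (2 * j + 1) * θ) (by positivity)
    (by rw [abs_mul, abs_of_pos hk]; gcongr)
  have e1 : (((2 * j + 1) * x : ℝ) : ℂ) - ((2 * j + 1) * θ : ℝ) * Complex.I =
      (2 * j + 1) * (x - θ * Complex.I) := by push_cast; ring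
  have e2 : (((2 * j + 1) * x : ℝ) : ℂ) = (2 * j + 1) * x := by push_cast; ring
  rw [e1, e2, bosePart, bosePart] at h4
  have e3 : 2 / (2 * j + 1 : ℂ) * (Complex.exp ((2 * j + 1 : ℂ) * (x - θ * Complex.I)) - 1)⁻¹ -
      2 / (2 * j + 1 : ℂ) * (Complex.exp ((2 * j + 1 : ℂ) * x) - 1)⁻¹ -
      2 * ((1 / (2 * j + 1 : ℝ) ^ 2 : ℝ) : ℂ) * ((x - θ * Complex.I : ℂ)⁻¹ - (x : ℂ)⁻¹) =
      2 / (2 * j + 1 : ℂ) * ((Complex.exp ((2 * j + 1 : ℂ) * (x - θ * Complex.I)) - 1)⁻¹ -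
        ((2 * j + 1 : ℂ) * (x - θ * Complex.I))⁻¹ -
        ((Complex.exp ((2 * j + 1 : ℂ) * x) - 1)⁻¹ - ((2 * j + 1 : ℂ) * x)⁻¹)) := by
    rw [mul_inv, mul_inv]
    generalize (Complex.exp ((2 * j + 1 : ℂ) * (x - θ * Complex.I)) - 1)⁻¹ = A
    generalize (Complex.exp ((2 * j + 1 : ℂ) * x) - 1)⁻¹ = B
    generalize (x - θ * Complex.I : ℂ)⁻¹ = Z
    generalize (x : ℂ)⁻¹ = X
    push_cast
    field_simp
    ring
  rw [e3, norm_mul, norm_div, hn, Complex.norm_ofNat]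
  refine (mul_le_mul_of_nonneg_left h4 (by positivity)).trans_eq ?_
  rw [Real.mul_rpow hk.le hx.le, abs_mul, abs_of_pos hk]
  field_simp
  ring

/-- The normalised integrand at the saddle point `x = y ^ 2`, `θ = y ^ 3 * v`. -/
noncomputable def saddleKernel (y v : ℝ) : ℂ :=
  Complex.exp (logOver ((y ^ 2 : ℝ) - (y ^ 3 * v : ℝ) * Complex.I) - logOver (y ^ 2 : ℝ) -
    (π ^ 2 / 4 * (v / y) : ℝ) * Complex.I)

lemma tendsto_nhdsGT_zero_id : Tendsto (fun y : ℝ => y) (𝓝[>] 0) (𝓝 0) :=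
  tendsto_nhdsWithin_of_tendsto_nhds tendsto_id

lemma tendsto_saddleKernel (v : ℝ) :
    Tendsto (fun y => saddleKernel y v) (𝓝[>] 0) (𝓝 (rexp (-(π ^ 2 / 4) * v ^ 2) : ℝ)) := by
  obtain ⟨C, hC⟩ := exists_norm_logOver_sub_le
  rw [Complex.ofReal_exp]
  refine (Complex.continuous_exp.tendsto _).comp ?_
  have hsmall : ∀ᶠ y : ℝ in 𝓝[>] 0, y * |v| < 1 := by
    have : Tendsto (fun y : ℝ => y * |v|) (𝓝[>] 0) (𝓝 (0 * |v|)) :=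
      tendsto_nhdsGT_zero_id.mul_const _
    rw [zero_mul] at this
    exact this.eventually_lt_const one_pos
  have hrem : Tendsto (fun y : ℝ => logOver ((y ^ 2 : ℝ) - (y ^ 3 * v : ℝ) * Complex.I) -
      logOver (y ^ 2 : ℝ) - (π : ℂ) ^ 2 / 4 *
        (((y ^ 2 : ℝ) - (y ^ 3 * v : ℝ) * Complex.I : ℂ)⁻¹ - ((y ^ 2 : ℝ) : ℂ)⁻¹))
      (𝓝[>] 0) (𝓝 0) := by
    have hb : Tendsto (fun y : ℝ => C * y ^ (1 / 2 : ℝ) * |v|) (𝓝[>] 0) (𝓝 0) := by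
      have h0 : Tendsto (fun y : ℝ => y ^ (1 / 2 : ℝ)) (𝓝[>] 0) (𝓝 0) := by
        have := tendsto_nhdsGT_zero_id.rpow_const (p := 1 / 2) (Or.inr (by norm_num))
        rwa [Real.zero_rpow (by norm_num)] at this
      simpa using (h0.const_mul C).mul_const |v|
    refine squeeze_zero_norm' ?_ hb
    filter_upwards [hsmall, self_mem_nhdsWithin] with y hy hy0
    have hy0 : 0 < y := hy0
    have habs : |y ^ 3 * v| = y ^ 3 * |v| := by rw [abs_mul, abs_of_pos (by positivity)]
    refine (hC (y ^ 2) (y ^ 3 * v) (by positivity) ?_).trans_eq ?_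
    · rw [habs]
      nlinarith [sq_nonneg y]
    · rw [habs, ← Real.rpow_natCast, ← Real.rpow_mul hy0.le, ← Real.rpow_natCast y 3,
        show (1 / 2 : ℝ) = (2 : ℕ) * (-(5 / 4)) + (3 : ℕ) by norm_num, Real.rpow_add hy0]
      ring
  have hmain : Tendsto (fun y : ℝ => (π : ℂ) ^ 2 / 4 * (-(v : ℂ) ^ 2 / (1 - y * v * Complex.I)))
      (𝓝[>] 0) (𝓝 (π ^ 2 / 4 * (-(v : ℂ) ^ 2 / 1))) := by
    refine Tendsto.const_mul _ (Tendsto.div tendsto_const_nhds ?_ one_ne_zero)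
    have : Tendsto (fun y : ℝ => (1 - y * v * Complex.I : ℂ)) (𝓝[>] 0)
        (𝓝 (1 - (0 : ℝ) * v * Complex.I)) :=
      tendsto_nhdsWithin_of_tendsto_nhds (Continuous.tendsto (by fun_prop) 0)
    simpa using this
  have h := hrem.add hmain
  have elim : (0 : ℂ) + π ^ 2 / 4 * (-(v : ℂ) ^ 2 / 1) = ((-(π ^ 2 / 4) * v ^ 2 : ℝ) : ℂ) := by
    push_cast; ring
  rw [elim] at h
  refine h.congr' ?_
  filter_upwards [self_mem_nhdsWithin] with y hy0
  have hy0 : (y : ℂ) ≠ 0 := by exact_mod_cast (ne_of_gt hy0)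
  have hd : (1 - y * v * Complex.I : ℂ) ≠ 0 := by
    intro h
    have := congrArg Complex.re h
    simp at this
  have e1 : ((y ^ 2 : ℝ) - (y ^ 3 * v : ℝ) * Complex.I : ℂ) = y ^ 2 * (1 - y * v * Complex.I) := by
    push_cast; ring
  rw [e1]
  generalize logOver _ = A
  generalize logOver _ = B
  have e2 : -(v : ℂ) ^ 2 / (1 - y * v * Complex.I) =
      (y ^ 2 * (1 - y * v * Complex.I) : ℂ)⁻¹ - ((y : ℂ) ^ 2)⁻¹ - v / y * Complex.I := by
    obtain ⟨D, hD⟩ : ∃ D : ℂ, D = 1 - y * v * Complex.I := ⟨_, rfl⟩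
    rw [← hD] at hd ⊢
    field_simp
    linear_combination (1 + y * v * Complex.I) * hD - (y * v : ℂ) ^ 2 * Complex.I_sq
  rw [e2]
  push_cast
  ring

lemma exp_neg_le_inv_one_add_sq_sq {y v : ℝ} (hv : |y ^ 3 * v| ≤ π) :
    rexp (-(v ^ 2 / (10 * (1 + y ^ 2 * v ^ 2)))) ≤ 10 ^ 14 / (1 + v ^ 2) ^ 2 := by
  set D := 1 + y ^ 2 * v ^ 2 with hD
  have hD0 : 0 < D := by positivity
  rw [le_div_iff₀ (by positivity)]
  rcases le_or_gt (v ^ 2) 1 with h | h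
  · have h1 : rexp (-(v ^ 2 / (10 * D))) ≤ 1 := Real.exp_le_one_iff.mpr (by
      rw [neg_nonpos]; positivity)
    have h2 : (1 + v ^ 2) ^ 2 ≤ 4 := by nlinarith [sq_nonneg v]
    calc _ ≤ 1 * (4 : ℝ) := by gcongr
      _ ≤ _ := by norm_num
  have h1 := Real.pow_div_factorial_le_exp (v ^ 2 / (10 * D)) (by positivity) 6
  have h2 : D ^ 6 ≤ 32 * (1 + (y ^ 2 * v ^ 2) ^ 6) := by
    have := add_pow_le (zero_le_one' ℝ) (by positivity : 0 ≤ y ^ 2 * v ^ 2) 6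
    norm_num at this ⊢
    linarith
  have h3 : y ^ 12 * v ^ 4 ≤ 100 := by
    have h4 : (y ^ 3 * v) ^ 2 ≤ 10 := by
      have := sq_le_sq' (by linarith [abs_nonneg (y ^ 3 * v), Real.pi_pos]) hv
      rw [sq_abs] at this
      nlinarith [Real.pi_lt_d2, Real.pi_pos]
    have : y ^ 12 * v ^ 4 = ((y ^ 3 * v) ^ 2) ^ 2 := by ring
    rw [this]
    nlinarith [sq_nonneg (y ^ 3 * v)]
  have h4 : D ^ 6 ≤ 3232 * (v ^ 2) ^ 4 := by
    have h5 : (y ^ 2 * v ^ 2) ^ 6 = (y ^ 12 * v ^ 4) * (v ^ 2) ^ 4 := by ring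
    have h6 : 1 ≤ (v ^ 2) ^ 4 := one_le_pow₀ h.le
    rw [h5] at h2
    nlinarith
  have h7 : (1 + v ^ 2) ^ 2 ≤ 4 * (v ^ 2) ^ 2 := by nlinarith
  rw [Real.exp_neg, inv_mul_le_iff₀ (Real.exp_pos _)]
  refine le_trans ?_ (mul_le_mul_of_nonneg_right h1 (by norm_num))
  norm_num [Nat.factorial]
  rw [div_pow, div_div, div_mul_eq_mul_div, le_div_iff₀ (by positivity)]
  calc (1 + v ^ 2) ^ 2 * ((10 * D) ^ 6 * 720) = (1 + v ^ 2) ^ 2 * (10 ^ 6 * 720 * D ^ 6) := by ring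
    _ ≤ 4 * (v ^ 2) ^ 2 * (10 ^ 6 * 720 * (3232 * (v ^ 2) ^ 4)) := by gcongr
    _ ≤ _ := by nlinarith [pow_pos (by linarith : 0 < v ^ 2) 6]

lemma norm_saddleKernel_le {y v : ℝ} (hy : 0 < y) (hy1 : y ≤ 1) (hv : |y ^ 3 * v| ≤ π) :
    ‖saddleKernel y v‖ ≤ 10 ^ 14 / (1 + v ^ 2) ^ 2 := by
  refine le_trans ?_ (exp_neg_le_inv_one_add_sq_sq hv)
  rw [saddleKernel, Complex.norm_exp, Real.exp_le_exp]
  refine le_trans ?_ ((re_logOver_decay (x := y ^ 2) (by positivity) (pow_le_one₀ hy.le hy1)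
    hv).trans_eq ?_)
  · rw [Complex.sub_re, Complex.sub_re, Complex.re_ofReal_mul, Complex.I_re, mul_zero, sub_zero]
  · congr 1
    field_simp

lemma measurable_saddleKernel {y : ℝ} (hy : 0 < y) : Measurable (saddleKernel y) := by
  have h1 : Measurable fun v : ℝ =>
      Complex.exp (logOver ((y ^ 2 : ℝ) - (y ^ 3 * v : ℝ) * Complex.I)) := by
    refine measurable_of_tendsto_metrizable (f := fun K (v : ℝ) => ∏ i ∈ Finset.range K,
      (1 + Complex.exp (-((y ^ 2 : ℝ) - (y ^ 3 * v : ℝ) * Complex.I)) ^ (i + 1)) /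
      (1 - Complex.exp (-((y ^ 2 : ℝ) - (y ^ 3 * v : ℝ) * Complex.I)) ^ (i + 1)))
      (fun K => by fun_prop) ?_
    rw [tendsto_pi_nhds]
    intro v
    refine tendsto_prod_exp_logOver ?_
    have : 0 < y ^ 2 := by positivity
    simpa [← Complex.ofReal_pow] using this
  have h2 : saddleKernel y = fun v : ℝ =>
      Complex.exp (logOver ((y ^ 2 : ℝ) - (y ^ 3 * v : ℝ) * Complex.I)) /
      Complex.exp (logOver (y ^ 2 : ℝ)) /
      Complex.exp ((π ^ 2 / 4 * (v / y) : ℝ) * Complex.I) := by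
    ext v
    rw [saddleKernel, Complex.exp_sub, Complex.exp_sub]
  rw [h2]
  exact (h1.div_const _).div (by fun_prop)

lemma abs_pow_mul_le_pi {y v : ℝ} (hy : 0 < y)
    (hv : v ∈ Set.Ioc (-(π / y ^ 3)) (π / y ^ 3)) : |y ^ 3 * v| ≤ π := by
  have hy3 : 0 < y ^ 3 := by positivity
  have := abs_le.mpr ⟨hv.1.le, hv.2⟩
  rw [abs_mul, abs_of_pos hy3]
  rwa [le_div_iff₀ hy3, mul_comm] at this

lemma norm_saddleKernel_mul_le {C : ℝ} {y v : ℝ} {w : ℂ} (hy : 0 < y) (hy1 : y ≤ 1)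
    (hv : v ∈ Set.Ioc (-(π / y ^ 3)) (π / y ^ 3)) (hw : ‖w‖ ≤ C * (1 + v ^ 2)) :
    ‖saddleKernel y v * w‖ ≤ 10 ^ 14 * C * (1 + v ^ 2)⁻¹ := by
  rw [norm_mul]
  calc ‖saddleKernel y v‖ * ‖w‖ ≤ 10 ^ 14 / (1 + v ^ 2) ^ 2 * (C * (1 + v ^ 2)) :=
        mul_le_mul (norm_saddleKernel_le hy hy1 (abs_pow_mul_le_pi hy hv)) hw (norm_nonneg _)
          (by positivity)
    _ = _ := by field_simp

lemma intervalIntegrable_saddleKernel_mul {g : ℝ → ℂ} {C y : ℝ} (hy : 0 < y) (hy1 : y ≤ 1)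
    (hg : Measurable g) (hb : ∀ v, ‖g v‖ ≤ C * (1 + v ^ 2)) :
    IntervalIntegrable (fun v => saddleKernel y v * g v) MeasureTheory.volume
      (-(π / y ^ 3)) (π / y ^ 3) := by
  have hle : -(π / y ^ 3) ≤ π / y ^ 3 := by
    have : 0 < π / y ^ 3 := by positivity
    linarith
  rw [intervalIntegrable_iff_integrableOn_Ioc_of_le hle]
  refine MeasureTheory.Integrable.mono'
    (integrable_inv_one_add_sq.const_mul (10 ^ 14 * C)).restrict
    ((measurable_saddleKernel hy).mul hg).aestronglyMeasurable ?_
  filter_upwards [MeasureTheory.ae_restrict_mem measurableSet_Ioc] with v hv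
  exact norm_saddleKernel_mul_le hy hy1 hv (hb v)

lemma tendsto_integral_saddleKernel_mul {f : ℝ → ℝ → ℂ} {f0 : ℝ → ℂ} (C : ℝ)
    (hmeas : ∀ y, Measurable (f y)) (hb : ∀ y v, 0 < y → ‖f y v‖ ≤ C * (1 + v ^ 2))
    (hlim : ∀ v, Tendsto (fun y => f y v) (𝓝[>] 0) (𝓝 (f0 v))) :
    Tendsto (fun y => ∫ v in (-(π / y ^ 3))..(π / y ^ 3), saddleKernel y v * f y v) (𝓝[>] 0)
      (𝓝 (∫ v, (rexp (-(π ^ 2 / 4) * v ^ 2) : ℝ) * f0 v)) := by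
  have hC : 0 ≤ C := by
    have := (norm_nonneg _).trans (hb 1 0 one_pos)
    simpa using this
  have key : Tendsto (fun y => ∫ v, (Set.Ioc (-(π / y ^ 3)) (π / y ^ 3)).indicator
      (fun v => saddleKernel y v * f y v) v) (𝓝[>] 0)
      (𝓝 (∫ v, (rexp (-(π ^ 2 / 4) * v ^ 2) : ℝ) * f0 v)) := by
    have hev : ∀ᶠ y : ℝ in 𝓝[>] 0, 0 < y ∧ y ≤ 1 :=
      Filter.mem_of_superset (Ioc_mem_nhdsGT one_pos) fun y hy => hy
    refine MeasureTheory.tendsto_integral_filter_of_dominated_convergence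
      (fun v => 10 ^ 14 * C * (1 + v ^ 2)⁻¹) ?_ ?_ (integrable_inv_one_add_sq.const_mul _) ?_
    · filter_upwards [hev] with y hy
      exact (((measurable_saddleKernel hy.1).mul (hmeas y)).indicator
        measurableSet_Ioc).aestronglyMeasurable
    · filter_upwards [hev] with y hy
      refine .of_forall fun v => ?_
      by_cases hv : v ∈ Set.Ioc (-(π / y ^ 3)) (π / y ^ 3)
      · rw [Set.indicator_of_mem hv]
        exact norm_saddleKernel_mul_le hy.1 hy.2 hv (hb y v hy.1)
      · rw [Set.indicator_of_notMem hv, norm_zero]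
        positivity
    · refine .of_forall fun v => ?_
      refine ((tendsto_saddleKernel v).mul (hlim v)).congr' ?_
      have hsm : ∀ᶠ y : ℝ in 𝓝[>] 0, y ^ 3 * (|v| + 1) < π := by
        have : Tendsto (fun y : ℝ => y ^ 3 * (|v| + 1)) (𝓝[>] 0) (𝓝 (0 ^ 3 * (|v| + 1))) :=
          (tendsto_nhdsGT_zero_id.pow 3).mul_const _
        norm_num at this
        exact this.eventually_lt_const Real.pi_pos
      filter_upwards [hev, hsm] with y hy hys
      rw [Set.indicator_of_mem]
      have h3 : 0 < y ^ 3 := pow_pos hy.1 3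
      have : |v| + 1 < π / y ^ 3 := by rw [lt_div_iff₀ h3]; linarith
      constructor <;> linarith [neg_abs_le v, le_abs_self v]
  refine key.congr' ?_
  filter_upwards [self_mem_nhdsWithin] with y hy0
  have hy0 : 0 < y := hy0
  have : 0 < π / y ^ 3 := by positivity
  rw [MeasureTheory.integral_indicator measurableSet_Ioc,
    intervalIntegral.integral_of_le (by linarith)]

/-- The saddle point integral with frequency shifted by `s`. -/
noncomputable def saddleIntegral (y s : ℝ) : ℂ :=
  ∫ v in (-(π / y ^ 3))..(π / y ^ 3),
    saddleKernel y v * Complex.exp (-(s * y ^ 3 * v : ℝ) * Complex.I)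

lemma pbar_mul_exp_eq {m : ℕ} {y s : ℝ} (hy : 0 < y) (hm : (m : ℝ) = π ^ 2 / 4 / y ^ 4 + s) :
    2 * π * pbar m * rexp (-(m * y ^ 2)) =
      y ^ 3 * rexp (logOver (y ^ 2 : ℝ)).re * (saddleIntegral y s).re := by
  have h := integral_exp_logOver m (x := y ^ 2) (by positivity)
  have h3 : y ^ 3 ≠ 0 := by positivity
  have hsub := intervalIntegral.integral_comp_mul_left (a := -(π / y ^ 3)) (b := π / y ^ 3)
    (fun θ : ℝ => Complex.exp (logOver ((y ^ 2 : ℝ) - θ * Complex.I)) *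
      Complex.exp (-(m * θ * Complex.I))) h3
  rw [show y ^ 3 * -(π / y ^ 3) = -π by field_simp, show y ^ 3 * (π / y ^ 3) = π by field_simp,
    h] at hsub
  have hint : ∀ v : ℝ, Complex.exp (logOver ((y ^ 2 : ℝ) - (y ^ 3 * v : ℝ) * Complex.I)) *
      Complex.exp (-(m * (y ^ 3 * v : ℝ) * Complex.I)) =
      (rexp (logOver (y ^ 2 : ℝ)).re : ℂ) * (saddleKernel y v *
        Complex.exp (-(s * y ^ 3 * v : ℝ) * Complex.I)) := by
    intro v
    rw [Complex.ofReal_exp, ofReal_logOver_re, saddleKernel, ← Complex.exp_add, ← Complex.exp_add,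
      ← Complex.exp_add]
    congr 1
    have hm' : ((m : ℝ) : ℂ) * (y ^ 3 * v : ℝ) = (π ^ 2 / 4 * (v / y) + s * y ^ 3 * v : ℝ) := by
      rw [← Complex.ofReal_mul, hm]
      congr 1
      field_simp
    rw [Complex.ofReal_natCast] at hm'
    rw [hm']
    push_cast
    ring
  simp only [hint] at hsub
  rw [intervalIntegral.integral_const_mul] at hsub
  have h5 : (2 * π * (pbar m * Complex.exp (-(y ^ 2 : ℝ)) ^ m) : ℂ) =
      ((y ^ 3 * rexp (logOver (y ^ 2 : ℝ)).re : ℝ) : ℂ) * saddleIntegral y s := by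
    rw [saddleIntegral, Complex.ofReal_mul, mul_assoc (((y ^ 3 : ℝ)) : ℂ), hsub, Complex.real_smul]
    have hc : (y : ℂ) ≠ 0 := by exact_mod_cast hy.ne'
    push_cast
    field_simp
  rw [← Complex.exp_nat_mul] at h5
  have h6 := congrArg Complex.re h5
  rw [Complex.re_ofReal_mul] at h6
  rw [← h6]
  have : (2 * π * (pbar m * Complex.exp (m * -(y ^ 2 : ℝ))) : ℂ) =
    ((2 * π * pbar m * rexp (-(m * y ^ 2)) : ℝ) : ℂ) := by
    push_cast
    ring_nf
  rw [this, Complex.ofReal_re]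

lemma intervalIntegrable_saddleKernel_mul_exp {y : ℝ} (hy : 0 < y) (hy1 : y ≤ 1) (s : ℝ) :
    IntervalIntegrable (fun v => saddleKernel y v *
      Complex.exp (-(s * y ^ 3 * v : ℝ) * Complex.I)) MeasureTheory.volume
      (-(π / y ^ 3)) (π / y ^ 3) := by
  refine intervalIntegrable_saddleKernel_mul (C := 1) hy hy1 (by fun_prop) fun v => ?_
  rw [← Complex.ofReal_neg, Complex.norm_exp_ofReal_mul_I]
  nlinarith [sq_nonneg v]

lemma eventually_pos_le_one : ∀ᶠ y : ℝ in 𝓝[>] 0, 0 < y ∧ y ≤ 1 :=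
  Filter.mem_of_superset (Ioc_mem_nhdsGT one_pos) fun _ hy => hy

lemma tendsto_saddleIntegral_zero :
    Tendsto (fun y => (saddleIntegral y 0).re) (𝓝[>] 0) (𝓝 (√(π / (π ^ 2 / 4)))) := by
  have h := tendsto_integral_saddleKernel_mul (f := fun _ _ => 1) (f0 := fun _ => 1) 1
    (fun _ => measurable_const) (fun y v _ => by simp; positivity) (fun v => tendsto_const_nhds)
  have h2 := (Complex.continuous_re.tendsto _).comp h
  simp only [mul_one] at h2
  rw [integral_complex_ofReal, Complex.ofReal_re, integral_gaussian] at h2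
  refine h2.congr fun y => ?_
  simp [saddleIntegral]

lemma tendsto_sin_mul_div (c : ℝ) {g : ℝ → ℝ} (hg : Tendsto g (𝓝[>] 0) (𝓝[>] 0)) :
    Tendsto (fun y => Real.sin (c * g y) / g y) (𝓝[>] 0) (𝓝 c) := by
  have h : HasDerivAt (fun u => Real.sin (c * u)) c 0 := by
    have := ((hasDerivAt_id (0:ℝ)).const_mul c).sin
    simpa using this
  have h2 := h.tendsto_slope_zero_right.comp hg
  refine h2.congr fun y => ?_
  simp [div_eq_inv_mul]

lemma tendsto_pow_nhdsGT_zero {k : ℕ} (hk : k ≠ 0) :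
    Tendsto (fun y : ℝ => y ^ k) (𝓝[>] 0) (𝓝[>] 0) := by
  refine tendsto_nhdsWithin_iff.mpr ⟨?_, ?_⟩
  · simpa [hk] using tendsto_nhdsGT_zero_id.pow k
  · filter_upwards [self_mem_nhdsWithin] with y hy
    exact pow_pos (Set.mem_Ioi.mp hy) k

lemma tendsto_saddleIntegral_diff :
    Tendsto (fun y => ((saddleIntegral y 1).re - (saddleIntegral y (-1)).re) / y ^ 3)
      (𝓝[>] 0) (𝓝 0) := by
  have h := tendsto_integral_saddleKernel_mul
    (f := fun y v => ((-(2 * (Real.sin (v * y ^ 3) / y ^ 3)) : ℝ) : ℂ) * Complex.I)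
    (f0 := fun v => ((-(2 * v) : ℝ) : ℂ) * Complex.I) 1
    (fun _ => by fun_prop) (fun y v hy => by
      have h1 : |Real.sin (v * y ^ 3)| ≤ |v| * y ^ 3 := by
        refine Real.abs_sin_le_abs.trans ?_
        rw [abs_mul, abs_of_pos (pow_pos hy 3)]
      rw [norm_mul, Complex.norm_I, mul_one, Complex.norm_real, norm_neg, norm_mul, norm_div,
        Real.norm_eq_abs (y ^ 3), abs_of_pos (pow_pos hy 3)]
      have h2 : ‖Real.sin (v * y ^ 3)‖ / y ^ 3 ≤ |v| := (div_le_iff₀ (pow_pos hy 3)).mpr h1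
      have h3 : ‖(2:ℝ)‖ = 2 := by norm_num
      rw [h3]
      nlinarith [sq_nonneg (|v| - 1), sq_abs v])
    (fun v => by
      refine Tendsto.mul_const _ ((Complex.continuous_ofReal.tendsto _).comp ?_)
      exact ((tendsto_sin_mul_div v (tendsto_pow_nhdsGT_zero three_ne_zero)).const_mul 2).neg)
  have h2 := (Complex.continuous_re.tendsto _).comp h
  have h0 : (∫ v : ℝ, ((rexp (-(π ^ 2 / 4) * v ^ 2) : ℝ) : ℂ) *
      (((-(2 * v) : ℝ) : ℂ) * Complex.I)).re = 0 := by
    have : (fun v : ℝ => ((rexp (-(π ^ 2 / 4) * v ^ 2) : ℝ) : ℂ) *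
      (((-(2 * v) : ℝ) : ℂ) * Complex.I)) =
      fun v : ℝ => ((rexp (-(π ^ 2 / 4) * v ^ 2) * (-(2 * v)) : ℝ) : ℂ) * Complex.I := by
      ext v; push_cast; ring
    rw [this, MeasureTheory.integral_mul_const, integral_complex_ofReal, Complex.re_ofReal_mul,
      Complex.I_re, mul_zero]
  rw [h0] at h2
  refine h2.congr' ?_
  filter_upwards [eventually_pos_le_one] with y hy
  have hy0 : y ≠ 0 := hy.1.ne'
  have h3 : y ^ 3 ≠ 0 := pow_ne_zero 3 hy0
  rw [← Complex.sub_re, saddleIntegral, saddleIntegral,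
    ← intervalIntegral.integral_sub (intervalIntegrable_saddleKernel_mul_exp hy.1 hy.2 _)
      (intervalIntegrable_saddleKernel_mul_exp hy.1 hy.2 _), ← Complex.div_ofReal_re,
    ← intervalIntegral.integral_div]
  simp only [Function.comp_apply]
  congr 2
  ext v
  rw [← mul_sub, mul_div_assoc]
  congr 1
  have hc : ((y ^ 3 : ℝ) : ℂ) ≠ 0 := by exact_mod_cast h3
  rw [eq_div_iff hc, ← Complex.ofReal_neg, ← Complex.ofReal_neg, Complex.exp_mul_I,
    Complex.exp_mul_I, ← Complex.ofReal_cos, ← Complex.ofReal_sin, ← Complex.ofReal_cos,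
    ← Complex.ofReal_sin]
  rw [show -(1 * y ^ 3 * v) = -(v * y ^ 3) by ring, show -(-1 * y ^ 3 * v) = v * y ^ 3 by ring,
    Real.cos_neg, Real.sin_neg, mul_right_comm, ← Complex.ofReal_mul,
    show -(2 * (Real.sin (v * y ^ 3) / y ^ 3)) * y ^ 3 = -(2 * Real.sin (v * y ^ 3)) by
      field_simp]
  push_cast
  ring

lemma integral_sq_mul_gaussian {b : ℝ} (hb : 0 < b) :
    ∫ v : ℝ, rexp (-b * v ^ 2) * v ^ 2 = √(π / b) / (2 * b) := by
  have hi1 : MeasureTheory.Integrable fun v : ℝ => rexp (-b * v ^ 2) :=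
    integrable_exp_neg_mul_sq hb
  have hi2 : MeasureTheory.Integrable fun v : ℝ => rexp (-b * v ^ 2) * v ^ 2 := by
    have := integrable_rpow_mul_exp_neg_mul_sq hb (s := 2) (by norm_num)
    simp only [Real.rpow_two] at this
    refine this.congr (.of_forall fun v => ?_)
    exact mul_comm _ _
  have hi3 : MeasureTheory.Integrable fun v : ℝ => v * rexp (-b * v ^ 2) :=
    integrable_mul_exp_neg_mul_sq hb
  have hd : ∀ v : ℝ, HasDerivAt (fun v : ℝ => v * rexp (-b * v ^ 2))
      (rexp (-b * v ^ 2) - 2 * b * (rexp (-b * v ^ 2) * v ^ 2)) v := by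
    intro v
    refine ((hasDerivAt_id v).fun_mul (((hasDerivAt_pow 2 v).const_mul (-b)).exp)).congr_deriv ?_
    simp only [id_eq, Nat.cast_ofNat]
    ring
  have h := MeasureTheory.integral_eq_zero_of_hasDerivAt_of_integrable hd
    (hi1.sub (hi2.const_mul (2 * b))) hi3
  rw [MeasureTheory.integral_sub hi1 (hi2.const_mul _), MeasureTheory.integral_const_mul,
    integral_gaussian] at h
  rw [eq_div_iff (by positivity)]
  linarith

lemma tendsto_saddleIntegral_second_diff :
    Tendsto (fun y => ((saddleIntegral y 1).re + (saddleIntegral y (-1)).re -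
      2 * (saddleIntegral y 0).re) / y ^ 6)
      (𝓝[>] 0) (𝓝 (-(√(π / (π ^ 2 / 4)) / (2 * (π ^ 2 / 4))))) := by
  have h := tendsto_integral_saddleKernel_mul
    (f := fun y v => ((-(2 * (Real.sin (v / 2 * y ^ 3) / y ^ 3)) ^ 2 : ℝ) : ℂ))
    (f0 := fun v => ((-(2 * (v / 2)) ^ 2 : ℝ) : ℂ)) 1
    (fun _ => by fun_prop) (fun y v hy => by
      have h1 : |Real.sin (v / 2 * y ^ 3)| ≤ |v / 2| * y ^ 3 := by
        refine Real.abs_sin_le_abs.trans ?_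
        rw [abs_mul, abs_of_pos (pow_pos hy 3)]
      have h2 : |Real.sin (v / 2 * y ^ 3) / y ^ 3| ≤ |v / 2| := by
        rw [abs_div, abs_of_pos (pow_pos hy 3)]
        exact (div_le_iff₀ (pow_pos hy 3)).mpr h1
      have h3 := sq_le_sq.mpr h2
      rw [Complex.norm_real, norm_neg, Real.norm_eq_abs, abs_of_nonneg (sq_nonneg _)]
      nlinarith)
    (fun v => by
      refine (Complex.continuous_ofReal.tendsto _).comp ?_
      exact (((tendsto_sin_mul_div (v / 2)
        (tendsto_pow_nhdsGT_zero three_ne_zero)).const_mul 2).pow 2).neg)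
  have h2 := (Complex.continuous_re.tendsto _).comp h
  have h0 : (∫ v : ℝ, ((rexp (-(π ^ 2 / 4) * v ^ 2) : ℝ) : ℂ) *
      ((-(2 * (v / 2)) ^ 2 : ℝ) : ℂ)).re = -(√(π / (π ^ 2 / 4)) / (2 * (π ^ 2 / 4))) := by
    have : (fun v : ℝ => ((rexp (-(π ^ 2 / 4) * v ^ 2) : ℝ) : ℂ) *
      ((-(2 * (v / 2)) ^ 2 : ℝ) : ℂ)) =
      fun v : ℝ => ((-(rexp (-(π ^ 2 / 4) * v ^ 2) * v ^ 2) : ℝ) : ℂ) := by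
      ext v; push_cast; ring
    rw [this, integral_complex_ofReal, Complex.ofReal_re, MeasureTheory.integral_neg,
      integral_sq_mul_gaussian (by positivity)]
  rw [h0] at h2
  refine h2.congr' ?_
  filter_upwards [eventually_pos_le_one] with y hy
  have hy0 : y ≠ 0 := hy.1.ne'
  have h3 : y ^ 3 ≠ 0 := pow_ne_zero 3 hy0
  have h6 : y ^ 6 ≠ 0 := (pow_pos hy.1 6).ne'
  have hi := fun s => intervalIntegrable_saddleKernel_mul_exp hy.1 hy.2 s
  rw [← Complex.re_ofReal_mul 2, ← Complex.add_re, ← Complex.sub_re, saddleIntegral,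
    saddleIntegral, saddleIntegral, ← intervalIntegral.integral_add (hi _) (hi _),
    ← intervalIntegral.integral_const_mul,
    ← intervalIntegral.integral_sub ((hi _).add (hi _)) ((hi _).const_mul _),
    ← Complex.div_ofReal_re, ← intervalIntegral.integral_div]
  simp only [Function.comp_apply]
  congr 2
  ext v
  have hc : ((y ^ 6 : ℝ) : ℂ) ≠ 0 := by exact_mod_cast h6
  rw [eq_div_iff hc, mul_assoc, ← Complex.ofReal_mul,
    show -(2 * (Real.sin (v / 2 * y ^ 3) / y ^ 3)) ^ 2 * y ^ 6 =
      -(4 * Real.sin (v / 2 * y ^ 3) ^ 2) by field_simp; ring]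
  rw [← Complex.ofReal_neg, ← Complex.ofReal_neg, ← Complex.ofReal_neg, Complex.exp_mul_I,
    Complex.exp_mul_I, Complex.exp_mul_I, ← Complex.ofReal_cos, ← Complex.ofReal_sin,
    ← Complex.ofReal_cos, ← Complex.ofReal_sin, ← Complex.ofReal_cos, ← Complex.ofReal_sin]
  rw [show -(1 * y ^ 3 * v) = -(2 * (v / 2 * y ^ 3)) by ring,
    show -(-1 * y ^ 3 * v) = 2 * (v / 2 * y ^ 3) by ring, show -(0 * y ^ 3 * v) = 0 by ring,
    Real.cos_neg, Real.sin_neg, Real.cos_zero, Real.sin_zero, Real.cos_two_mul,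
    Real.cos_sq']
  push_cast
  ring

lemma inv_sq_sub_inv_le {w : ℝ} (hw : 0 < w) : 1 / w ^ 2 - 1 / w ≤ (rexp (w ^ 2) - 1)⁻¹ := by
  have hw2 : 0 < w ^ 2 := by positivity
  have he : 0 < rexp (w ^ 2) - 1 := by linarith [Real.add_one_lt_exp hw2.ne']
  rcases le_or_gt w 1 with h | h
  · have h1 : 1 / w ^ 2 - 1 ≤ (rexp (w ^ 2) - 1)⁻¹ := by
      have h2 : 1 - w ^ 2 ≤ rexp (-w ^ 2) := by linarith [Real.add_one_le_exp (-w ^ 2)]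
      rw [Real.exp_neg] at h2
      rw [inv_eq_one_div, le_div_iff₀ he, div_sub_one hw2.ne', div_mul_eq_mul_div,
        div_le_one hw2]
      have h3 := mul_le_mul_of_nonneg_right h2 (Real.exp_pos (w ^ 2)).le
      rw [inv_mul_cancel₀ (Real.exp_pos _).ne'] at h3
      linarith
    have : 1 ≤ 1 / w := (one_le_div hw).mpr h
    linarith
  · have h1 : 1 / w ^ 2 ≤ 1 / w := one_div_le_one_div_of_le hw (by nlinarith)
    have : 0 < (rexp (w ^ 2) - 1)⁻¹ := inv_pos.mpr he
    linarith

lemma exists_le_re_logOver :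
    ∃ C : ℝ, ∀ y : ℝ, 0 < y → π ^ 2 / 4 / y ^ 2 - C / y ≤ (logOver (y ^ 2 : ℝ)).re := by
  refine ⟨2 * ∑' j : ℕ, (2 * j + 1 : ℝ) ^ (-(3 / 2) : ℝ), fun y hy => ?_⟩
  have h1 := (hasSum_one_div_odd_sq.mul_left (2 / y ^ 2)).sub
    ((summable_odd_rpow (p := -(3 / 2)) (by norm_num)).hasSum.mul_left (2 / y))
  have h2 := hasSum_re_logOver (z := (y ^ 2 : ℝ)) (by rw [Complex.ofReal_re]; positivity)
  refine le_trans (le_of_eq (by ring)) (hasSum_le (fun j => ?_) h1 h2)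
  have hj : (0 : ℝ) < 2 * j + 1 := by positivity
  have hs : 0 < √(2 * j + 1 : ℝ) := Real.sqrt_pos.mpr hj
  have hs2 : √(2 * j + 1 : ℝ) ^ 2 = 2 * j + 1 := Real.sq_sqrt hj.le
  have h3 := inv_sq_sub_inv_le (mul_pos hs hy)
  have h4 : (Complex.exp ((2 * j + 1 : ℂ) * (y ^ 2 : ℝ)) - 1)⁻¹.re =
      (rexp ((√(2 * j + 1 : ℝ) * y) ^ 2) - 1)⁻¹ := by
    rw [← re_inv_exp_sub_one_ofReal, mul_pow, hs2]
    push_cast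
    rfl
  have h5 : (2 * j + 1 : ℝ) ^ (-(3 / 2) : ℝ) = 1 / ((2 * j + 1) * √(2 * j + 1)) := by
    rw [Real.rpow_neg hj.le, show (3 / 2 : ℝ) = 1 + 1 / 2 by norm_num, Real.rpow_add hj,
      Real.rpow_one, ← Real.sqrt_eq_rpow, one_div]
  rw [h4, h5]
  refine le_trans (le_of_eq ?_) (mul_le_mul_of_nonneg_left h3 (by positivity))
  rw [mul_pow, hs2]
  field_simp

lemma tendsto_sq_mul_log : Tendsto (fun y : ℝ => y ^ 2 * log y) (𝓝[>] 0) (𝓝 0) := by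
  have := tendsto_log_mul_rpow_nhdsGT_zero (r := 2) (by norm_num)
  refine this.congr fun y => ?_
  rw [Real.rpow_two, mul_comm]

lemma sqrt_pi_div_pos : 0 < √(π / (π ^ 2 / 4)) := Real.sqrt_pos.mpr (by positivity)

lemma tendsto_saddleIntegral_add :
    Tendsto (fun y => (saddleIntegral y 1).re + (saddleIntegral y (-1)).re) (𝓝[>] 0)
      (𝓝 (2 * √(π / (π ^ 2 / 4)))) := by
  have h := (tendsto_saddleIntegral_second_diff.mul (tendsto_nhdsGT_zero_id.pow 6)).add
    (tendsto_saddleIntegral_zero.const_mul 2)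
  norm_num at h
  refine Tendsto.congr' ?_ h
  filter_upwards [self_mem_nhdsWithin] with y hy
  have : y ≠ 0 := (Set.mem_Ioi.mp hy).ne'
  field_simp
  ring

lemma tendsto_saddleIntegral_sub :
    Tendsto (fun y => (saddleIntegral y 1).re - (saddleIntegral y (-1)).re) (𝓝[>] 0) (𝓝 0) := by
  have h := tendsto_saddleIntegral_diff.mul (tendsto_nhdsGT_zero_id.pow 3)
  rw [zero_mul] at h
  refine h.congr' ?_
  filter_upwards [self_mem_nhdsWithin] with y hy
  have : y ≠ 0 := (Set.mem_Ioi.mp hy).ne'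
  field_simp

lemma tendsto_saddleIntegral_one :
    Tendsto (fun y => (saddleIntegral y 1).re) (𝓝[>] 0) (𝓝 (√(π / (π ^ 2 / 4)))) := by
  have h := (tendsto_saddleIntegral_add.add tendsto_saddleIntegral_sub).div_const 2
  convert h using 1
  · ext y; ring
  · congr 1; ring

lemma tendsto_saddleIntegral_neg_one :
    Tendsto (fun y => (saddleIntegral y (-1)).re) (𝓝[>] 0) (𝓝 (√(π / (π ^ 2 / 4)))) := by
  have h := (tendsto_saddleIntegral_add.sub tendsto_saddleIntegral_sub).div_const 2
  convert h using 1
  · ext y; ring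
  · congr 1; ring

/-- Lower bound for the second difference of the logarithms of the saddle point integrals. -/
lemma exists_log_second_diff_ge :
    ∃ E : ℝ → ℝ, Tendsto E (𝓝[>] 0) (𝓝 (-(1 / (2 * (π ^ 2 / 4))))) ∧ ∀ᶠ y in 𝓝[>] 0,
      E y * y ^ 6 ≤ log (saddleIntegral y 1).re + log (saddleIntegral y (-1)).re -
        2 * log (saddleIntegral y 0).re := by
  set J := √(π / (π ^ 2 / 4)) with hJ
  have hJ0 : 0 < J := sqrt_pi_div_pos
  refine ⟨fun y => ((((saddleIntegral y 1).re + (saddleIntegral y (-1)).re -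
      2 * (saddleIntegral y 0).re) / y ^ 6) * (((saddleIntegral y 1).re +
      (saddleIntegral y (-1)).re + 2 * (saddleIntegral y 0).re) / 4) -
      (((saddleIntegral y 1).re - (saddleIntegral y (-1)).re) / y ^ 3) ^ 2 / 4) /
      ((saddleIntegral y 1).re * (saddleIntegral y (-1)).re), ?_, ?_⟩
  · have h := ((tendsto_saddleIntegral_second_diff.mul ((tendsto_saddleIntegral_add.add
      (tendsto_saddleIntegral_zero.const_mul 2)).div_const 4)).sub
      ((tendsto_saddleIntegral_diff.pow 2).div_const 4)).div
      (tendsto_saddleIntegral_one.mul tendsto_saddleIntegral_neg_one) (mul_pos hJ0 hJ0).ne'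
    refine (congrArg (Tendsto _ _) (congrArg 𝓝 ?_)).mp h
    rw [← hJ]
    field_simp
    ring
  · filter_upwards [self_mem_nhdsWithin,
      tendsto_saddleIntegral_zero.eventually_const_lt sqrt_pi_div_pos,
      tendsto_saddleIntegral_one.eventually_const_lt sqrt_pi_div_pos,
      tendsto_saddleIntegral_neg_one.eventually_const_lt sqrt_pi_div_pos] with y hy h0 h1 h2
    have hy0 : y ≠ 0 := (Set.mem_Ioi.mp hy).ne'
    have h3 := Real.one_sub_inv_le_log_of_pos (div_pos (mul_pos h1 h2) (pow_pos h0 2))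
    rw [Real.log_div (mul_pos h1 h2).ne' (pow_pos h0 2).ne', Real.log_mul h1.ne' h2.ne',
      Real.log_pow] at h3
    refine le_trans (le_of_eq ?_) h3
    generalize (saddleIntegral y 0).re = a at *
    generalize (saddleIntegral y 1).re = b at *
    generalize (saddleIntegral y (-1)).re = c at *
    field_simp
    ring

/-- Upper bound for the first difference of the logarithms of the saddle point integrals. -/
lemma exists_log_diff_le :
    ∃ E : ℝ → ℝ, Tendsto E (𝓝[>] 0) (𝓝 0) ∧ ∀ᶠ y in 𝓝[>] 0,
      log (saddleIntegral y 1).re - log (saddleIntegral y (-1)).re ≤ E y * y ^ 2 := by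
  refine ⟨fun y => (((saddleIntegral y 1).re - (saddleIntegral y (-1)).re) / y ^ 3) * y /
    (saddleIntegral y (-1)).re, ?_, ?_⟩
  · have h := (tendsto_saddleIntegral_diff.mul tendsto_nhdsGT_zero_id).div
      tendsto_saddleIntegral_neg_one sqrt_pi_div_pos.ne'
    rwa [mul_zero, zero_div] at h
  · filter_upwards [self_mem_nhdsWithin,
      tendsto_saddleIntegral_one.eventually_const_lt sqrt_pi_div_pos,
      tendsto_saddleIntegral_neg_one.eventually_const_lt sqrt_pi_div_pos] with y hy h1 h2
    have hy0 : y ≠ 0 := (Set.mem_Ioi.mp hy).ne'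
    have h3 := Real.log_le_sub_one_of_pos (div_pos h1 h2)
    rw [Real.log_div h1.ne' h2.ne'] at h3
    refine h3.trans (le_of_eq ?_)
    field_simp

lemma eventually_saddle_pos (α : ℝ) :
    ∀ᶠ y in 𝓝[>] (0 : ℝ), 0 < 2 * (y ^ 4 / (π ^ 2 / 4)) * (3 * log y - log (2 * π) +
      (logOver (y ^ 2 : ℝ)).re + log (saddleIntegral y 0).re) + π ^ 2 / 4 / y ^ 4 *
      (log (saddleIntegral y 1).re + log (saddleIntegral y (-1)).re -
        2 * log (saddleIntegral y 0).re) -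
      (log (saddleIntegral y 1).re - log (saddleIntegral y (-1)).re) -
      2 * α * (y ^ 4 / (π ^ 2 / 4)) * (log (π ^ 2 / 4) - 4 * log y) := by
  obtain ⟨E, hE, hE'⟩ := exists_log_second_diff_ge
  obtain ⟨F, hF, hF'⟩ := exists_log_diff_le
  obtain ⟨C, hC⟩ := exists_le_re_logOver
  have hκ : 0 < π ^ 2 / 4 := by positivity
  set κ := π ^ 2 / 4 with hκdef
  have hsq : Tendsto (fun y : ℝ => y ^ 2) (𝓝[>] 0) (𝓝 0) := by
    simpa using tendsto_nhdsGT_zero_id.pow 2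
  have hlim : Tendsto (fun y => 2 / κ * (3 * (y ^ 2 * log y) - y ^ 2 * log (2 * π) +
      (κ - C * y) + y ^ 2 * log (saddleIntegral y 0).re) + κ * E y - F y -
      2 * α / κ * (y ^ 2 * log κ - 4 * (y ^ 2 * log y))) (𝓝[>] 0)
      (𝓝 (2 / κ * (3 * 0 - 0 * log (2 * π) + (κ - C * 0) + 0 * log √(π / κ)) +
        κ * (-(1 / (2 * κ))) - 0 - 2 * α / κ * (0 * log κ - 4 * 0))) :=
    ((((((((tendsto_sq_mul_log.const_mul 3).sub (hsq.mul_const _)).add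
      ((tendsto_nhdsGT_zero_id.const_mul C).const_sub κ)).add
      (hsq.mul (tendsto_saddleIntegral_zero.log sqrt_pi_div_pos.ne'))).const_mul _).add
      (hE.const_mul κ)).sub hF).sub
      (((hsq.mul_const _).sub (tendsto_sq_mul_log.const_mul 4)).const_mul _))
  have hval : 0 < 2 / κ * (3 * 0 - 0 * log (2 * π) + (κ - C * 0) + 0 * log √(π / κ)) +
        κ * (-(1 / (2 * κ))) - 0 - 2 * α / κ * (0 * log κ - 4 * 0) := by
    have : 2 / κ * (3 * 0 - 0 * log (2 * π) + (κ - C * 0) + 0 * log √(π / κ)) +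
        κ * (-(1 / (2 * κ))) - 0 - 2 * α / κ * (0 * log κ - 4 * 0) = 3 / 2 := by
      field_simp
      ring
    rw [this]
    norm_num
  filter_upwards [self_mem_nhdsWithin, hE', hF',
    hlim.eventually_const_lt hval] with y hy hEy hFy hy1
  have hy0 : 0 < y := hy
  have h1 : 2 * (y ^ 4 / κ) * (κ / y ^ 2 - C / y) ≤
      2 * (y ^ 4 / κ) * (logOver (y ^ 2 : ℝ)).re :=
    mul_le_mul_of_nonneg_left (hC y hy0) (by positivity)
  have h2 : 2 * (y ^ 4 / κ) * (κ / y ^ 2 - C / y) = y ^ 2 * (2 / κ * (κ - C * y)) := by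
    field_simp
  have h3 := mul_le_mul_of_nonneg_left hEy (by positivity : 0 ≤ κ / y ^ 4)
  have h4 : κ / y ^ 4 * (E y * y ^ 6) = y ^ 2 * (κ * E y) := by
    field_simp
  have h5 := mul_pos (pow_pos hy0 2) hy1
  generalize log (saddleIntegral y 0).re = a at *
  generalize log (saddleIntegral y 1).re = b at *
  generalize log (saddleIntegral y (-1)).re = c at *
  have h6 : y ^ 2 * (2 / κ * (3 * (y ^ 2 * log y) - y ^ 2 * log (2 * π) + (κ - C * y) +
      y ^ 2 * a) + κ * E y - F y - 2 * α / κ * (y ^ 2 * log κ - 4 * (y ^ 2 * log y))) =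
      2 * (y ^ 4 / κ) * (3 * log y - log (2 * π) + a) + y ^ 2 * (2 / κ * (κ - C * y)) +
      y ^ 2 * (κ * E y) - F y * y ^ 2 - 2 * α * (y ^ 4 / κ) * (log κ - 4 * log y) := by ring
  rw [h6] at h5
  have h7 : 2 * (y ^ 4 / κ) * (3 * log y - log (2 * π) + (logOver (y ^ 2 : ℝ)).re + a) =
    2 * (y ^ 4 / κ) * (3 * log y - log (2 * π) + a) +
      2 * (y ^ 4 / κ) * (logOver (y ^ 2 : ℝ)).re := by ring
  rw [h7]
  linarith

lemma pbar_pos (n : ℕ) : 0 < pbar n := by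
  refine Finset.sum_pos' (fun _ _ => Nat.zero_le _) ⟨0, by simp, ?_⟩
  refine Nat.mul_pos (Finset.card_pos.mpr ⟨default, ?_⟩) Fintype.card_pos
  simp [Nat.Partition.distincts]

lemma log_pbar_eq {m : ℕ} {y s : ℝ} (hy : 0 < y) (hm : (m : ℝ) = π ^ 2 / 4 / y ^ 4 + s) :
    log (pbar m) = m * y ^ 2 + 3 * log y - log (2 * π) + (logOver (y ^ 2 : ℝ)).re +
      log (saddleIntegral y s).re := by
  have h := pbar_mul_exp_eq hy hm
  have hp : (0 : ℝ) < pbar m := by exact_mod_cast pbar_pos m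
  have hy3 : 0 < y ^ 3 := by positivity
  have hq : 0 < (saddleIntegral y s).re := by
    have h1 : 0 < 2 * π * pbar m * rexp (-(m * y ^ 2)) := by positivity
    rw [h] at h1
    exact pos_of_mul_pos_right h1 (by positivity)
  have h2 := congrArg log h
  rw [Real.log_mul (by positivity) (Real.exp_pos _).ne', Real.log_mul (by positivity) hp.ne',
    Real.log_mul (by positivity) hq.ne', Real.log_mul hy3.ne' (Real.exp_pos _).ne',
    Real.log_exp, Real.log_exp, Real.log_pow] at h2
  rw [Nat.cast_ofNat] at h2
  linarith

lemma rseq_pos (α : ℝ) {n : ℕ} (hn : 0 < n) : 0 < rseq α n := by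
  have hp : (0 : ℝ) < pbar n := by exact_mod_cast pbar_pos n
  unfold rseq
  positivity

lemma log_rseq (α : ℝ) {n : ℕ} (hn : 0 < n) :
    log (rseq α n) = (log (pbar n) - α * log n) / n := by
  have hp : (0 : ℝ) < pbar n := by exact_mod_cast pbar_pos n
  have hn' : (0 : ℝ) < n := by exact_mod_cast hn
  rw [rseq, Real.log_rpow (by positivity), Real.log_div hp.ne' (by positivity),
    Real.log_rpow hn', inv_mul_eq_div]

lemma log_add_one_add_log_sub_one_le {x : ℝ} (hx : 2 ≤ x) :
    log (x + 1) + log (x - 1) ≤ 2 * log x := by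
  rw [← Real.log_mul (by linarith) (by linarith), show 2 * log x = log (x ^ 2) by
    rw [Real.log_pow, Nat.cast_ofNat]]
  exact Real.log_le_log (by nlinarith) (by nlinarith)

/-- The second difference of `(g - α * log) / id` in terms of the differences of `g`. -/
lemma second_diff_div_pos {x g₀ g₁ g₂ α : ℝ} (hα : 0 ≤ α) (hx : 2 ≤ x)
    (h : 0 < 2 * (1 / x) * g₀ + x * (g₁ + g₂ - 2 * g₀) - (g₁ - g₂) - 2 * α * (1 / x) * log x) :
    2 * ((g₀ - α * log x) / x) <
      (g₂ - α * log (x - 1)) / (x - 1) + (g₁ - α * log (x + 1)) / (x + 1) := by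
  have hconc := log_add_one_add_log_sub_one_le hx
  have hmono : log (x - 1) ≤ log (x + 1) := Real.log_le_log (by linarith) (by linarith)
  have hlog : 0 ≤ α * (x * (2 * log x - (log (x + 1) + log (x - 1))) +
      (log (x + 1) - log (x - 1))) :=
    mul_nonneg hα (add_nonneg (mul_nonneg (by linarith) (by linarith)) (by linarith))
  generalize log (x - 1) = a at *
  generalize log (x + 1) = b at *
  generalize log x = c at *
  have hexp : (g₂ - α * a) / (x - 1) + (g₁ - α * b) / (x + 1) - 2 * ((g₀ - α * c) / x) =
      (2 * (1 / x) * g₀ + x * (g₁ + g₂ - 2 * g₀) - (g₁ - g₂) - 2 * α * (1 / x) * c +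
        α * (x * (2 * c - (b + a)) + (b - a))) / ((x - 1) * (x + 1)) := by
    have h1 : x - 1 ≠ 0 := by linarith
    have h2 : x + 1 ≠ 0 := by linarith
    have h3 : x ≠ 0 := by linarith
    field_simp
    ring
  rw [← sub_pos, hexp]
  exact div_pos (by linarith) (mul_pos (by linarith) (by linarith))

lemma sq_rseq_lt {α : ℝ} (hα : 0 ≤ α) {n : ℕ} (hn : 2 ≤ n) {y : ℝ} (hy : 0 < y)
    (hyn : (n : ℝ) = π ^ 2 / 4 / y ^ 4)
    (h : 0 < 2 * (y ^ 4 / (π ^ 2 / 4)) * (3 * log y - log (2 * π) +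
      (logOver (y ^ 2 : ℝ)).re + log (saddleIntegral y 0).re) + π ^ 2 / 4 / y ^ 4 *
      (log (saddleIntegral y 1).re + log (saddleIntegral y (-1)).re -
        2 * log (saddleIntegral y 0).re) -
      (log (saddleIntegral y 1).re - log (saddleIntegral y (-1)).re) -
      2 * α * (y ^ 4 / (π ^ 2 / 4)) * (log (π ^ 2 / 4) - 4 * log y)) :
    rseq α n ^ 2 < rseq α (n - 1) * rseq α (n + 1) := by
  have hn2 : (2 : ℝ) ≤ n := by exact_mod_cast hn
  have hm : ((n - 1 : ℕ) : ℝ) = n - 1 := by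
    rw [Nat.cast_sub (by omega), Nat.cast_one]
  have hp : ((n + 1 : ℕ) : ℝ) = n + 1 := Nat.cast_succ n
  have hlogn : log n = log (π ^ 2 / 4) - 4 * log y := by
    rw [hyn, Real.log_div (by positivity) (by positivity), Real.log_pow y 4, Nat.cast_ofNat]
  have hinv : y ^ 4 / (π ^ 2 / 4) = 1 / n := by rw [hyn, one_div_div]
  rw [← hyn, ← hlogn, hinv] at h
  have h0 := log_pbar_eq hy (m := n) (s := 0) (by rw [hyn, add_zero])
  have h1 := log_pbar_eq hy (m := n + 1) (s := 1) (by rw [hp, hyn])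
  have h2 := log_pbar_eq hy (m := n - 1) (s := -1) (by rw [hm, hyn, sub_eq_add_neg])
  have hpos0 := rseq_pos α (n := n) (by omega)
  have hpos1 := rseq_pos α (n := n + 1) (by omega)
  have hpos2 := rseq_pos α (n := n - 1) (by omega)
  rw [← Real.log_lt_log_iff (pow_pos hpos0 2) (mul_pos hpos2 hpos1), Real.log_pow,
    Real.log_mul hpos2.ne' hpos1.ne', log_rseq α (by omega : 0 < n),
    log_rseq α (by omega : 0 < n + 1), log_rseq α (by omega : 0 < n - 1), hm, hp,
    Nat.cast_ofNat]
  rw [hp] at h1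
  rw [hm] at h2
  refine second_diff_div_pos hα hn2 (lt_of_lt_of_eq h ?_)
  rw [h0, h1, h2]
  have hc : (n : ℝ) ≠ 0 := by linarith
  clear hyn hinv hlogn h h0 h1 h2
  field_simp
  ring

lemma eventually_sq_rseq_lt {α : ℝ} (hα : 0 ≤ α) :
    ∀ᶠ n : ℕ in atTop, rseq α n ^ 2 < rseq α (n - 1) * rseq α (n + 1) := by
  have hκ : 0 < π ^ 2 / 4 := by positivity
  have ht : Tendsto (fun n : ℕ => (π ^ 2 / 4 / n) ^ (1 / 4 : ℝ)) atTop (𝓝[>] 0) := by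
    refine tendsto_nhdsWithin_iff.mpr ⟨?_, ?_⟩
    · have := (tendsto_const_div_atTop_nhds_zero_nat (π ^ 2 / 4)).rpow_const
        (p := 1 / 4) (Or.inr (by norm_num))
      rwa [Real.zero_rpow (by norm_num)] at this
    · filter_upwards [eventually_gt_atTop 0] with n hn
      have : (0 : ℝ) < n := by exact_mod_cast hn
      exact Set.mem_Ioi.mpr (by positivity)
  filter_upwards [eventually_ge_atTop 2, ht.eventually (eventually_saddle_pos α)] with n hn h
  have hn0 : (0 : ℝ) < n := by exact_mod_cast (by omega : 0 < n)
  refine sq_rseq_lt hα hn (by positivity) ?_ h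
  rw [← Real.rpow_mul_natCast (by positivity), show (1 / 4 : ℝ) * (4 : ℕ) = 1 by norm_num,
    Real.rpow_one]
  field_simp

lemma turan_neg_of_sq_lt {a b c d : ℝ} (hb : 0 < b) (hc : 0 < c)
    (h1 : b ^ 2 < a * c) (h2 : c ^ 2 < b * d) :
    4 * (b ^ 2 - a * c) * (c ^ 2 - b * d) - (b * c - a * d) ^ 2 < 0 := by
  set X := a * c / b ^ 2 - 1 with hX
  set Y := b * d / c ^ 2 - 1 with hY
  have hX0 : 0 < X := sub_pos.mpr ((one_lt_div (by positivity)).mpr h1)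
  have hY0 : 0 < Y := sub_pos.mpr ((one_lt_div (by positivity)).mpr h2)
  have hac : a = (1 + X) * b ^ 2 / c := by rw [hX]; field_simp; ring
  have hbd : d = (1 + Y) * c ^ 2 / b := by rw [hY]; field_simp; ring
  clear_value X Y
  have key : 4 * (b ^ 2 - a * c) * (c ^ 2 - b * d) - (b * c - a * d) ^ 2 =
      -(b ^ 2 * c ^ 2 * ((X - Y) ^ 2 + 2 * (X + Y) * (X * Y) + X ^ 2 * Y ^ 2)) := by
    rw [hac, hbd]
    field_simp
    ring
  rw [key, neg_lt_zero]
  positivity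

theorem stmt5 (α : ℝ) (hα : 0 ≤ α) :
    ∃ NT : ℕ, 0 < NT ∧ ∀ n : ℕ, NT ≤ n →
      4 * ((rseq α n) ^ 2 - rseq α (n - 1) * rseq α (n + 1)) *
          ((rseq α (n + 1)) ^ 2 - rseq α n * rseq α (n + 2)) -
        (rseq α n * rseq α (n + 1) - rseq α (n - 1) * rseq α (n + 2)) ^ 2 < 0 := by
  obtain ⟨N, hN⟩ := eventually_atTop.mp (eventually_sq_rseq_lt hα)
  refine ⟨N + 2, by omega, fun n hn => ?_⟩
  have h1 := hN n (by omega)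
  have h2 := hN (n + 1) (by omega)
  exact turan_neg_of_sq_lt (rseq_pos α (by omega)) (rseq_pos α (by omega)) h1 h2
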